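/- Let N ≥ 1, let B be the open unit ball of ℝ^N, and let f ∈ C¹(ℝ) satisfy conditions (2) and (3). Assume in addition that f is increasing up to a linear perturbation, i.e. there exist a nondecreasing function f̃ : ℝ → ℝ and a constant K such that f(t) = f̃(t) − K t for all t ∈ ℝ. Then for any two boundary blow-up solutions u₁, u₂ of Δu = f(u) in B, the gradient of the difference is bounded: |∇(u₁ − u₂)| ∈ L^∞(B). -/

import Mathlib

open MeasureTheory Filter Metric Set Topology

/-- The Euclidean Laplacian: sum of pure second partial derivatives. -/
noncomputable def lap {N : ℕ} (u : EuclideanSpace ℝ (Fin N) → ℝ)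
    (x : EuclideanSpace ℝ (Fin N)) : ℝ :=
  ∑ i, fderiv ℝ (fun y => fderiv ℝ u y (EuclideanSpace.single i 1)) x (EuclideanSpace.single i 1)

/-- A boundary blow-up solution of `Δu = f(u)` on the open unit ball. -/
def IsBlowUp {N : ℕ} (f : ℝ → ℝ) (u : EuclideanSpace ℝ (Fin N) → ℝ) : Prop :=
  ContDiffOn ℝ 2 u (ball 0 1) ∧
  (∀ x ∈ ball (0 : EuclideanSpace ℝ (Fin N)) 1, lap u x = f (u x)) ∧
  ∀ x₀ : EuclideanSpace ℝ (Fin N), ‖x₀‖ = 1 →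
    Tendsto u (𝓝[ball (0 : EuclideanSpace ℝ (Fin N)) 1] x₀) atTop

def HD2 {G : Type*} [NormedAddCommGroup G] [NormedSpace ℝ G] (g : ℝ → G) (p q : G) : Prop :=
  ∃ g' : ℝ → G, (∀ᶠ t in 𝓝 (0:ℝ), HasDerivAt g (g' t) t) ∧ g' 0 = p ∧ HasDerivAt g' q 0

lemma HD2.add {G : Type*} [NormedAddCommGroup G] [NormedSpace ℝ G] {g h : ℝ → G} {p q p' q' : G}
    (hg : HD2 g p q) (hh : HD2 h p' q') : HD2 (fun t => g t + h t) (p + p') (q + q') := by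
  obtain ⟨g', h1, h2, h3⟩ := hg
  obtain ⟨k', k1, k2, k3⟩ := hh
  refine ⟨fun t => g' t + k' t, ?_, by simp only [h2, k2], h3.add k3⟩
  filter_upwards [h1, k1] with t a b using a.add b

lemma HD2.sub {G : Type*} [NormedAddCommGroup G] [NormedSpace ℝ G] {g h : ℝ → G} {p q p' q' : G}
    (hg : HD2 g p q) (hh : HD2 h p' q') : HD2 (fun t => g t - h t) (p - p') (q - q') := by
  obtain ⟨g', h1, h2, h3⟩ := hg
  obtain ⟨k', k1, k2, k3⟩ := hh
  refine ⟨fun t => g' t - k' t, ?_, by simp only [h2, k2], h3.sub k3⟩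
  filter_upwards [h1, k1] with t a b using a.sub b

lemma HD2.const_mul {g : ℝ → ℝ} {p q : ℝ} (c : ℝ)
    (hg : HD2 g p q) : HD2 (fun t => c * g t) (c * p) (c * q) := by
  obtain ⟨g', h1, h2, h3⟩ := hg
  refine ⟨fun t => c * g' t, ?_, by simp only [h2], h3.const_mul c⟩
  filter_upwards [h1] with t a using a.const_mul c

lemma HD2.smul_const {G : Type*} [NormedAddCommGroup G] [NormedSpace ℝ G] {g : ℝ → ℝ} {p q : ℝ}
    (hg : HD2 g p q) (c : G) : HD2 (fun t => g t • c) (p • c) (q • c) := by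
  obtain ⟨g', h1, h2, h3⟩ := hg
  refine ⟨fun t => g' t • c, ?_, by simp only [h2], h3.smul_const c⟩
  filter_upwards [h1] with t a using a.smul_const c

lemma HD2.const {G : Type*} [NormedAddCommGroup G] [NormedSpace ℝ G] (c : G) :
    HD2 (fun _ => c) 0 0 :=
  ⟨fun _ => 0, Eventually.of_forall fun t => hasDerivAt_const t c, rfl, hasDerivAt_const _ _⟩

lemma HD2.poly (a b c : ℝ) : HD2 (fun t => a + b * t + c * t ^ 2) b (2 * c) := by
  refine ⟨fun t => b + 2 * c * t, Eventually.of_forall fun t => ?_, by simp, ?_⟩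
  · have := (((hasDerivAt_id t).const_mul b).const_add a).add (((hasDerivAt_id t).pow 2).const_mul c)
    exact this.congr_deriv (by simp; ring)
  · have := ((hasDerivAt_id (0:ℝ)).const_mul (2*c)).const_add b
    exact this.congr_deriv (by simp)

lemma HD2.exp {g : ℝ → ℝ} {p q : ℝ} (hg : HD2 g p q) :
    HD2 (fun t => Real.exp (g t)) (Real.exp (g 0) * p) (Real.exp (g 0) * (p ^ 2 + q)) := by
  obtain ⟨g', h1, h2, h3⟩ := hg
  refine ⟨fun t => Real.exp (g t) * g' t, ?_, by simp only [h2], ?_⟩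
  · filter_upwards [h1] with t a using a.exp
  · have := (h1.self_of_nhds.exp).mul h3
    exact this.congr_deriv (by rw [h2]; ring)

lemma HD2.line {G : Type*} [NormedAddCommGroup G] [NormedSpace ℝ G] (x v : G) :
    HD2 (fun t : ℝ => x + t • v) v 0 := by
  have h := (HD2.const x).add ((HD2.poly 0 1 0).smul_const v)
  simpa using h

lemma HD2.congr {G : Type*} [NormedAddCommGroup G] [NormedSpace ℝ G] {g h : ℝ → G} {p q p' q' : G}
    (hg : HD2 g p q) (e : ∀ t, h t = g t) (hp : p' = p) (hq : q' = q) : HD2 h p' q' := by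
  have : h = g := funext e
  subst this hp hq
  exact hg

lemma HD2.nonneg_of_min {g : ℝ → ℝ} {p q : ℝ} (hg : HD2 g p q) (hm : IsLocalMin g 0) :
    p = 0 ∧ 0 ≤ q := by
  obtain ⟨g', h1, h2, h3⟩ := hg
  have hp : g' 0 = 0 := hm.hasDerivAt_eq_zero h1.self_of_nhds
  refine ⟨h2 ▸ hp, ?_⟩
  by_contra hq
  push Not at hq
  have e1 : deriv g =ᶠ[𝓝 0] g' := by
    filter_upwards [h1] with t a using a.deriv
  have hd : deriv (deriv g) 0 = q := by rw [e1.deriv_eq]; exact h3.deriv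
  have hM : IsLocalMax g 0 := by
    refine isLocalMax_of_deriv_deriv_neg (by rw [hd]; exact hq) (by rw [e1.self_of_nhds, hp])
      h1.self_of_nhds.continuousAt
  have hc : g =ᶠ[𝓝 0] fun _ => g 0 := by
    filter_upwards [hm, hM] with t a b using le_antisymm b a
  have e2 : deriv g =ᶠ[𝓝 0] fun _ => (0:ℝ) := by
    have := hc.deriv
    refine this.trans (Eventually.of_forall fun t => by simp)
  rw [e2.deriv_eq] at hd
  simp at hd
  linarith

noncomputable def D2 {N : ℕ} (u : EuclideanSpace ℝ (Fin N) → ℝ) (x v : EuclideanSpace ℝ (Fin N)) : ℝ :=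
  fderiv ℝ (fderiv ℝ u) x v v

lemma HD2.comp_u {N : ℕ} {u : EuclideanSpace ℝ (Fin N) → ℝ} {γ : ℝ → EuclideanSpace ℝ (Fin N)}
    {p q x : EuclideanSpace ℝ (Fin N)} (hγ : HD2 γ p q) (hx : γ 0 = x) (hu : ContDiffAt ℝ 2 u x) :
    HD2 (fun t => u (γ t)) (fderiv ℝ u x p) (D2 u x p + fderiv ℝ u x q) := by
  obtain ⟨g', h1, h2, h3⟩ := hγ
  subst hx h2
  have hc : ContinuousAt γ 0 := h1.self_of_nhds.continuousAt
  have hev : ∀ᶠ y in 𝓝 (γ 0), ContDiffAt ℝ 2 u y := hu.eventually (by simp)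
  refine ⟨fun t => fderiv ℝ u (γ t) (g' t), ?_, rfl, ?_⟩
  · filter_upwards [h1, hc.eventually hev] with t a b
    exact (b.differentiableAt (by simp)).hasFDerivAt.comp_hasDerivAt t a
  · have hd : DifferentiableAt ℝ (fderiv ℝ u) (γ 0) :=
      (hu.fderiv_right (m := 1) (by norm_num)).differentiableAt (by simp)
    have h4 : HasDerivAt (fun t => fderiv ℝ u (γ t)) (fderiv ℝ (fderiv ℝ u) (γ 0) (g' 0)) 0 :=
      hd.hasFDerivAt.comp_hasDerivAt 0 h1.self_of_nhds
    exact h4.clm_apply h3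

lemma lap_eq_basis {N : ℕ} {u : EuclideanSpace ℝ (Fin N) → ℝ} {x : EuclideanSpace ℝ (Fin N)}
    (hu : ContDiffAt ℝ 2 u x) (b : OrthonormalBasis (Fin N) ℝ (EuclideanSpace ℝ (Fin N))) :
    ∑ i, D2 u x (b i) = lap u x := by
  have hd : DifferentiableAt ℝ (fderiv ℝ u) x :=
      (hu.fderiv_right (m := 1) (by norm_num)).differentiableAt (by simp)
  set B := fderiv ℝ (fderiv ℝ u) x with hB
  set e := EuclideanSpace.basisFun (Fin N) ℝ with he
  have h1 : lap u x = ∑ i, B (e i) (e i) := by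
    unfold lap
    refine Finset.sum_congr rfl fun i _ => ?_
    rw [fderiv_clm_apply hd (differentiableAt_const _)]
    simp [he, hB]
  have h2 : ∀ i, B (b i) (b i) = ∑ j, ∑ k, inner ℝ (e j) (b i) * inner ℝ (b i) (e k) * B (e j) (e k) := by
    intro i
    conv_lhs => rw [← e.sum_repr' (b i)]
    simp only [map_sum, map_smul, sum_apply, smul_apply, smul_eq_mul, Finset.mul_sum]
    rw [Finset.sum_comm]
    refine Finset.sum_congr rfl fun j _ => Finset.sum_congr rfl fun k _ => ?_
    rw [real_inner_comm (b i) (e k)]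
    ring
  unfold D2
  rw [h1]
  simp_rw [← hB, h2]
  rw [Finset.sum_comm]
  refine Finset.sum_congr rfl fun j _ => ?_
  rw [Finset.sum_comm]
  simp_rw [← Finset.sum_mul, b.sum_inner_mul_inner]
  rw [Finset.sum_eq_single j]
  · simp
  · intro k _ hk
    have : inner ℝ (e j) (e k) = (0:ℝ) := e.orthonormal.2 hk.symm
    rw [this]; simp
  · simp
lemma D2_smul {N : ℕ} (u : EuclideanSpace ℝ (Fin N) → ℝ) (x v : EuclideanSpace ℝ (Fin N)) (c : ℝ) :
    D2 u x (c • v) = c ^ 2 * D2 u x v := by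
  unfold D2
  simp; ring

lemma HD2.cos : HD2 Real.cos 0 (-1) := by
  refine ⟨fun t => - Real.sin t, Eventually.of_forall fun t => Real.hasDerivAt_cos t, by simp, ?_⟩
  exact (Real.hasDerivAt_sin 0).neg.congr_deriv (by simp)

lemma HD2.sin : HD2 Real.sin 1 0 := by
  refine ⟨fun t => Real.cos t, Eventually.of_forall fun t => Real.hasDerivAt_sin t, by simp, ?_⟩
  exact (Real.hasDerivAt_cos 0).congr_deriv (by simp)

lemma exists_basis {N : ℕ} (ω : EuclideanSpace ℝ (Fin N)) (hω : ‖ω‖ = 1) :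
    ∃ (b : OrthonormalBasis (Fin N) ℝ (EuclideanSpace ℝ (Fin N))) (i₀ : Fin N), b i₀ = ω := by
  have hN : 0 < N := by
    rcases Nat.eq_zero_or_pos N with h | h
    · subst h
      have : ω = 0 := Subsingleton.elim _ _
      simp [this] at hω
    · exact h
  let i₀ : Fin N := ⟨0, hN⟩
  have ho : Orthonormal ℝ (Set.domRestrict ({i₀} : Set (Fin N)) (fun _ : Fin N => ω)) := by
    constructor
    · intro i; exact hω
    · intro i j hij
      exact absurd (Subsingleton.elim i j) hij
  obtain ⟨b, hb⟩ := ho.exists_orthonormalBasis_extension_of_card_eq (by simp)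
  exact ⟨b, i₀, hb i₀ rfl⟩

lemma tang_le {N : ℕ} {u : EuclideanSpace ℝ (Fin N) → ℝ} {ω : EuclideanSpace ℝ (Fin N)} {r : ℝ}
    (hr : 0 < r) (hω : ‖ω‖ = 1)
    (hu : ContDiffAt ℝ 2 u (r • ω)) (hmax : ∀ x, ‖x‖ = r → u x ≤ u (r • ω)) :
    lap u (r • ω) ≤ D2 u (r • ω) ω + (N - 1) / r * fderiv ℝ u (r • ω) ω := by
  obtain ⟨b, i₀, hb⟩ := exists_basis ω hω
  rw [← lap_eq_basis hu b]
  have key : ∀ i, i ≠ i₀ → D2 u (r • ω) (b i) ≤ 1 / r * fderiv ℝ u (r • ω) ω := by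
    intro i hi
    have h1 := (HD2.cos.smul_const (r • ω)).add (HD2.sin.smul_const (r • b i))
    have h2 := h1.comp_u (x := r • ω) (by simp) hu
    have h3 := h2.const_mul (-1)
    have hin : inner ℝ ω (b i) = (0:ℝ) := by
      rw [← hb]; exact b.orthonormal.2 hi.symm
    have hbi : ‖b i‖ = 1 := b.orthonormal.1 i
    have := (h3.nonneg_of_min ?_).2
    · simp only [zero_smul, one_smul, zero_add, D2_smul, add_zero, neg_smul, map_neg, map_smul, smul_eq_mul] at this
      rw [div_mul_eq_mul_div, le_div_iff₀ hr]
      have h5 : r * (D2 u (r • ω) (b i) * r - fderiv ℝ u (r • ω) ω) ≤ 0 := by nlinarith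
      by_contra hcon
      push Not at hcon
      nlinarith
    · refine Eventually.of_forall fun t => ?_
      simp only [Real.cos_zero, Real.sin_zero, one_smul, zero_smul, add_zero]
      have : u (Real.cos t • r • ω + Real.sin t • r • b i) ≤ u (r • ω) := by
        apply hmax
        rw [← sq_eq_sq₀ (norm_nonneg _) hr.le, norm_add_sq_real]
        simp only [norm_smul, inner_smul_left, inner_smul_right, hin, hω, hbi, Real.norm_eq_abs]
        simp only [mul_pow, sq_abs]
        have := Real.sin_sq_add_cos_sq t
        simp
        linear_combination r^2 * this
      linarith
  rw [← Finset.add_sum_erase _ _ (Finset.mem_univ i₀), hb]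
  have h2 : ∑ i ∈ Finset.univ.erase i₀, D2 u (r • ω) (b i) ≤
      ∑ i ∈ Finset.univ.erase i₀, 1 / r * fderiv ℝ u (r • ω) ω :=
    Finset.sum_le_sum fun i hi => key i (Finset.ne_of_mem_erase hi)
  rw [Finset.sum_const, Finset.card_erase_of_mem (Finset.mem_univ _), Finset.card_univ, Fintype.card_fin, nsmul_eq_mul,
    Nat.cast_sub (by have := i₀.2; omega)] at h2
  have e : ((N:ℝ) - 1) / r * fderiv ℝ u (r • ω) ω = (↑N - ↑1) * (1 / r * (fderiv ℝ u (r • ω)) ω) := by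
    push_cast; ring
  rw [e]
  push_cast at h2 ⊢
  linarith

lemma lap_neg {N : ℕ} (u : EuclideanSpace ℝ (Fin N) → ℝ) (x : EuclideanSpace ℝ (Fin N)) :
    lap (fun y => - u y) x = - lap u x := by
  unfold lap
  simp [fderiv_fun_neg]

lemma D2_neg {N : ℕ} (u : EuclideanSpace ℝ (Fin N) → ℝ) (x v : EuclideanSpace ℝ (Fin N)) :
    D2 (fun y => - u y) x v = - D2 u x v := by
  unfold D2
  have : fderiv ℝ (fun y => - u y) = fun y => - fderiv ℝ u y := by
    ext1 y; exact fderiv_fun_neg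
  rw [this, fderiv_fun_neg]; simp

lemma tang_ge {N : ℕ} {u : EuclideanSpace ℝ (Fin N) → ℝ} {ω : EuclideanSpace ℝ (Fin N)} {r : ℝ}
    (hr : 0 < r) (hω : ‖ω‖ = 1)
    (hu : ContDiffAt ℝ 2 u (r • ω)) (hmin : ∀ x, ‖x‖ = r → u (r • ω) ≤ u x) :
    D2 u (r • ω) ω + (N - 1) / r * fderiv ℝ u (r • ω) ω ≤ lap u (r • ω) := by
  have := tang_le (u := fun y => - u y) hr hω hu.neg (fun x hx => neg_le_neg (hmin x hx))
  rw [lap_neg, D2_neg, fderiv_fun_neg] at this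
  simp at this
  linarith

lemma IsBlowUp.cd {N : ℕ} {f : ℝ → ℝ} {u : EuclideanSpace ℝ (Fin N) → ℝ} (hu : IsBlowUp f u)
    {x : EuclideanSpace ℝ (Fin N)} (hx : ‖x‖ < 1) : ContDiffAt ℝ 2 u x :=
  hu.1.contDiffAt (isOpen_ball.mem_nhds (by simpa using hx))

lemma IsBlowUp.eq {N : ℕ} {f : ℝ → ℝ} {u : EuclideanSpace ℝ (Fin N) → ℝ} (hu : IsBlowUp f u)
    {x : EuclideanSpace ℝ (Fin N)} (hx : ‖x‖ < 1) : lap u x = f (u x) :=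
  hu.2.1 x (by simpa using hx)

lemma IsBlowUp.unif {N : ℕ} {f : ℝ → ℝ} {u : EuclideanSpace ℝ (Fin N) → ℝ} (hu : IsBlowUp f u)
    (A : ℝ) : ∃ ρ : ℝ, 0 < ρ ∧ ρ < 1 ∧ ∀ x, ρ ≤ ‖x‖ → ‖x‖ < 1 → A < u x := by
  set Z := {x : EuclideanSpace ℝ (Fin N) | ‖x‖ < 1 ∧ u x ≤ A} with hZ
  have hZb : Z ⊆ closedBall 0 1 := fun x hx => by simpa using hx.1.le
  have hc : IsCompact (closure Z) :=
    (isCompact_closedBall (0 : EuclideanSpace ℝ (Fin N)) 1).of_isClosed_subset isClosed_closure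
      (closure_minimal hZb isClosed_closedBall)
  have hlt : ∀ x ∈ closure Z, ‖x‖ < 1 := by
    intro x hx
    have h1 : ‖x‖ ≤ 1 := by simpa using closure_minimal hZb isClosed_closedBall hx
    refine lt_of_le_of_ne h1 fun h => ?_
    have h2 := (hu.2.2 x h).eventually (eventually_gt_atTop A)
    rw [eventually_nhdsWithin_iff] at h2
    rw [mem_closure_iff_frequently] at hx
    obtain ⟨y, hy1, hy2⟩ := (hx.and_eventually h2).exists
    exact absurd (hy2 (by simpa using hy1.1)) (not_lt.2 hy1.2)
  rcases (closure Z).eq_empty_or_nonempty with he | hne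
  · refine ⟨1/2, by norm_num, by norm_num, fun x _ hx => ?_⟩
    by_contra hcon
    have : x ∈ closure Z := subset_closure ⟨hx, not_lt.1 hcon⟩
    simp [he] at this
  · obtain ⟨z, hz, hmax⟩ := hc.exists_isMaxOn hne continuous_norm.continuousOn
    have hz1 := hlt z hz
    have := norm_nonneg z
    refine ⟨(1 + ‖z‖) / 2, by positivity, by linarith, fun x hx1 hx2 => ?_⟩
    by_contra hcon
    have : ‖x‖ ≤ ‖z‖ := hmax (subset_closure ⟨hx2, not_lt.1 hcon⟩)
    linarith

lemma IsBlowUp.contOn {N : ℕ} {f : ℝ → ℝ} {u : EuclideanSpace ℝ (Fin N) → ℝ} (hu : IsBlowUp f u)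
    {s : Set (EuclideanSpace ℝ (Fin N))} (hs : ∀ x ∈ s, ‖x‖ < 1) : ContinuousOn u s :=
  fun _ hx => (hu.cd (hs _ hx)).continuousAt.continuousWithinAt

lemma inner_line_sq {N : ℕ} (x v : EuclideanSpace ℝ (Fin N)) (hv : ‖v‖ = 1) (t : ℝ) :
    ‖x + t • v‖ ^ 2 = ‖x‖ ^ 2 + 2 * inner ℝ x v * t + 1 * t ^ 2 := by
  rw [norm_add_sq_real, norm_smul, hv, inner_smul_right]
  simp; ring

lemma tendsto_line {N : ℕ} (x v : EuclideanSpace ℝ (Fin N)) :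
    Tendsto (fun t : ℝ => x + t • v) (𝓝 0) (𝓝 x) := by
  have : Continuous (fun t : ℝ => x + t • v) := by fun_prop
  simpa using this.tendsto 0

/-- monotonicity of the spherical maxima close to the boundary -/
lemma IsBlowUp.mono {N : ℕ} {f : ℝ → ℝ} {u : EuclideanSpace ℝ (Fin N) → ℝ} (hu : IsBlowUp f u)
    (hN : 1 ≤ N) {a : ℝ} (hf0 : ∀ t > a, 0 ≤ f t) :
    ∃ r₁ : ℝ, 0 < r₁ ∧ r₁ < 1 ∧ ∀ s, r₁ ≤ s → s < 1 → ∀ x, ‖x‖ ≤ s → ∃ y, ‖y‖ = s ∧ u x ≤ u y := by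
  have : Nonempty (Fin N) := ⟨⟨0, hN⟩⟩
  obtain ⟨r₀, h0, h1, h2⟩ := hu.unif a
  obtain ⟨z, hz, hzm⟩ := (isCompact_closedBall (0 : EuclideanSpace ℝ (Fin N)) r₀).exists_isMaxOn
    ⟨0, by simpa using h0.le⟩ (hu.contOn fun x hx => lt_of_le_of_lt (by simpa using hx) h1)
  obtain ⟨r₁, k0, k1, k2⟩ := hu.unif (u z)
  refine ⟨r₁, k0, k1, fun s hs1 hs2 x hx => ?_⟩
  obtain ⟨y, hy, hym⟩ := (isCompact_sphere (0 : EuclideanSpace ℝ (Fin N)) s).exists_isMaxOn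
    (NormedSpace.sphere_nonempty.2 (by linarith)) (hu.contOn fun x hx => by simp at hx; linarith)
  have hys : ‖y‖ = s := by simpa using hy
  refine ⟨y, hys, ?_⟩
  by_contra hcon
  push Not at hcon
  set δ := (u x - u y) / 2 with hδ
  have hδ0 : 0 < δ := by rw [hδ]; linarith
  have hcont : ContinuousOn (fun x => u x + δ * ‖x‖ ^ 2) (closedBall (0 : EuclideanSpace ℝ (Fin N)) s) := by
    have : ContinuousOn u (closedBall (0 : EuclideanSpace ℝ (Fin N)) s) :=
      hu.contOn fun x hx => lt_of_le_of_lt (by simpa using hx) hs2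
    fun_prop
  obtain ⟨p, hp, hpm⟩ := (isCompact_closedBall (0 : EuclideanSpace ℝ (Fin N)) s).exists_isMaxOn
    ⟨0, by simp; linarith⟩ hcont
  have hps : ‖p‖ ≤ s := by simpa using hp
  have hpx : u x + δ * ‖x‖ ^ 2 ≤ u p + δ * ‖p‖ ^ 2 := hpm (show x ∈ closedBall 0 s by simpa using hx)
  have hp1 : ‖p‖ ^ 2 ≤ 1 := by have := norm_nonneg p; nlinarith
  have hpu : u y < u p := by
    have : 0 ≤ δ * ‖x‖ ^ 2 := by positivity
    nlinarith
  have hp2 : ‖p‖ < s := by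
    refine lt_of_le_of_ne hps fun h => ?_
    have : u p ≤ u y := hym (show p ∈ sphere 0 s by simpa using h)
    linarith
  have hp3 : r₀ < ‖p‖ := by
    by_contra h
    have h3 : u p ≤ u z := hzm (show p ∈ closedBall 0 r₀ by simpa using h)
    have := k2 y (by linarith) (by linarith)
    linarith
  have hap : a < u p := h2 p hp3.le (by linarith)
  have hcd := hu.cd (show ‖p‖ < 1 by linarith)
  set b := EuclideanSpace.basisFun (Fin N) ℝ
  have key : ∀ i, D2 u p (b i) ≤ - (2 * δ) := by
    intro i
    have hbi : ‖b i‖ = 1 := b.orthonormal.1 i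
    have g1 := ((HD2.line p (b i)).comp_u (x := p) (by simp) hcd).add
      ((HD2.poly (‖p‖ ^ 2) (2 * inner ℝ p (b i)) 1).const_mul δ)
    have g2 := (g1.const_mul (-1)).nonneg_of_min ?_
    · have := g2.2
      simp at this
      linarith
    · have : ∀ᶠ t : ℝ in 𝓝 0, p + t • b i ∈ ball (0 : EuclideanSpace ℝ (Fin N)) s :=
        (tendsto_line p (b i)).eventually (isOpen_ball.mem_nhds (by simpa using hp2))
      filter_upwards [this] with t ht
      have h5 : u (p + t • b i) + δ * ‖p + t • b i‖ ^ 2 ≤ u p + δ * ‖p‖ ^ 2 := hpm (ball_subset_closedBall ht)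
      rw [inner_line_sq _ _ hbi] at h5
      simp only [zero_smul, add_zero]
      norm_num
      linarith
  have hs := Finset.sum_le_sum (fun i (_ : i ∈ Finset.univ) => key i)
  rw [lap_eq_basis hcd b, hu.eq (by linarith)] at hs
  have := hf0 _ hap
  simp at hs
  have hN' : (1:ℝ) ≤ N := by exact_mod_cast hN
  nlinarith
lemma alg_double {n K κ M ε s k r ρ φ' pu pv qu qv h h' A fu fv : ℝ}
    (hn : 0 ≤ n) (hK : 0 ≤ K) (hκ : κ = K + 1) (hM : M = 4 * n + 1) (hε : 0 < ε) (hε1 : ε < 1)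
    (hs : 0 ≤ s) (hs1 : 2 * M * s ≤ 1) (hk0 : 0 ≤ k) (hk1 : k ≤ 1) (hr : 1 / 2 ≤ r) (hr1 : r ≤ 1)
    (hρ : ρ = r + ε * k) (hφ' : φ' = 1 - 2 * ε * M * s)
    (hh : h ≤ 1) (hh' : h' ≤ 0) (hA : 0 < A)
    (hpu : 0 ≤ pu) (h1 : pu - φ' * pv - A * h' = 0)
    (h2 : qu - (φ' ^ 2 * qv - 2 * ε * M * pv) + 2 * κ * A ≤ 0)
    (h3 : fu ≤ qu + n / r * pu) (h4 : qv + n / ρ * pv ≤ fv) (h5 : fv - fu ≤ K * (A * h))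
    (h6 : 0 ≤ fv) : False := by
  have hr0 : 0 < r := by linarith
  have hM0 : 0 < M := by linarith
  have hes : ε * (2 * M * s) ≤ ε := by nlinarith
  have hes0 : 0 ≤ ε * (2 * M * s) := by positivity
  have hφ0 : 0 < φ' := by rw [hφ']; linarith
  have hφ1 : φ' ≤ 1 := by rw [hφ']; linarith
  have hρr : r ≤ ρ := by rw [hρ]; nlinarith
  have hρ0 : 0 < ρ := by linarith
  have hpv : 0 ≤ pv := by
    by_contra hc
    push Not at hc
    have t1 : φ' * pv < 0 := mul_neg_of_pos_of_neg hφ0 hc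
    have t2 : A * h' ≤ 0 := mul_nonpos_of_nonneg_of_nonpos hA.le hh'
    linarith
  have hb : n / r * φ' - n / ρ * φ' ^ 2 ≤ 2 * ε * M := by
    have e : n / r * φ' - n / ρ * φ' ^ 2 = n * φ' * (ρ - r * φ') / (r * ρ) := by
      field_simp
    rw [e, div_le_iff₀ (by positivity)]
    have e2 : ρ - r * φ' ≤ 2 * ε := by
      rw [hρ, hφ']
      have t1 : ε * k ≤ ε * 1 := by gcongr
      have t2 : r * (ε * (2 * M * s)) ≤ 1 * ε := by gcongr
      linarith
    have e3 : n * φ' * (ρ - r * φ') ≤ n * (2 * ε) := by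
      have e4 : 0 ≤ ρ - r * φ' := by
        have : r * φ' ≤ r * 1 := by gcongr
        linarith
      calc n * φ' * (ρ - r * φ') ≤ n * 1 * (2 * ε) := by gcongr
        _ = _ := by ring
    have e5 : 1 / 4 ≤ r * ρ := by
      have : (1 / 2) * (1 / 2) ≤ r * ρ := by gcongr; linarith
      linarith
    have e6 : 2 * ε * M * (1/4) ≤ 2 * ε * M * (r * ρ) := by gcongr
    have e7 : n * (2 * ε) ≤ 2 * ε * M * (1/4) := by
      rw [hM]
      have : 0 ≤ ε := hε.le
      linarith
    linarith
  have g1 : n / r * pu ≤ n / r * (φ' * pv) := by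
    apply mul_le_mul_of_nonneg_left _ (by positivity)
    have t2 : A * h' ≤ 0 := mul_nonpos_of_nonneg_of_nonpos hA.le hh'
    linarith
  have g2 : φ' ^ 2 * qv ≤ φ' ^ 2 * (fv - n / ρ * pv) := by
    apply mul_le_mul_of_nonneg_left _ (by positivity)
    linarith
  have g3 : φ' ^ 2 * fv ≤ fv := by
    have : φ' ^ 2 ≤ 1 := by nlinarith
    nlinarith
  have g4 : pv * (n / r * φ' - n / ρ * φ' ^ 2) ≤ pv * (2 * ε * M) :=
    mul_le_mul_of_nonneg_left hb hpv
  have g5 : K * (A * h) ≤ K * A := by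
    have : A * h ≤ A := by nlinarith
    exact mul_le_mul_of_nonneg_left this hK
  have g6 : 2 * κ * A ≤ K * A := by linarith
  rw [hκ] at g6
  have g7 : 0 ≤ K * A := by positivity
  linarith

lemma deriv_nonneg_of_left {g : ℝ → ℝ} {p : ℝ} (hg : HasDerivAt g p 0)
    (h : ∀ᶠ t in 𝓝[<] (0:ℝ), g t ≤ g 0) : 0 ≤ p := by
  have h1 := (hasDerivAt_iff_tendsto_slope.1 hg).mono_left (nhdsWithin_mono (0:ℝ) (show Iio (0:ℝ) ⊆ {0}ᶜ from fun x hx => ne_of_lt hx))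
  refine ge_of_tendsto h1 ?_
  filter_upwards [h, self_mem_nhdsWithin] with t ht (ht0 : t < 0)
  rw [slope_def_field]
  apply div_nonneg_of_nonpos <;> linarith

set_option maxHeartbeats 1000000 in
lemma double_eps {N : ℕ} {f : ℝ → ℝ} {u v : EuclideanSpace ℝ (Fin N) → ℝ} (hu : IsBlowUp f u)
    (hv : IsBlowUp f v) (hN : 1 ≤ N) {a K : ℝ} (hf0 : ∀ t > a, 0 ≤ f t)
    (hK : 0 ≤ K) (hKf : ∀ s t, s ≤ t → f s - f t ≤ K * (t - s))
    {r₁ κ M n A ε : ℝ} (hn : n = N - 1) (hκ : κ = K + 1) (hM : M = 4 * n + 1)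
    (hr1 : 1 / 2 ≤ r₁) (hr1' : r₁ < 1) (hr2 : 2 * M * (1 - r₁) ≤ 1) (hr3 : 2 * κ * (1 - r₁) ≤ 1)
    (hmono : ∀ s, r₁ ≤ s → s < 1 → ∀ x, ‖x‖ ≤ s → ∃ y, ‖y‖ = s ∧ u x ≤ u y)
    (hva : ∀ x, r₁ ≤ ‖x‖ → ‖x‖ < 1 → a < v x)
    (hA0 : 0 ≤ A) (hA : ∀ x, ‖x‖ = r₁ → u x - a ≤ A * ((1 - r₁) - κ * (1 - r₁) ^ 2))
    (hε : 0 < ε) (hε1 : ε < 1)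
    (x₁ y₁ : EuclideanSpace ℝ (Fin N)) (hx₁ : r₁ ≤ ‖x₁‖) (hx₁' : ‖x₁‖ < 1) 
    (hy₁ : ‖y₁‖ = ‖x₁‖ + ε * (1 - M * (‖x₁‖ - r₁) ^ 2)) (hy₁' : ‖y₁‖ < 1) :
    u x₁ - v y₁ ≤ A * ((1 - ‖x₁‖) - κ * (1 - ‖x₁‖) ^ 2) := by
  have hn0 : 0 ≤ n := by
    have : (1:ℝ) ≤ N := by exact_mod_cast hN
    linarith
  have hM1 : 1 ≤ M := by linarith
  have hκ1 : 1 ≤ κ := by linarith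
  set h : ℝ → ℝ := fun r => (1 - r) - κ * (1 - r) ^ 2 with hh
  set φ : ℝ → ℝ := fun r => r + ε * (1 - M * (r - r₁) ^ 2) with hφ
  have hhpos : ∀ r, r₁ ≤ r → r < 1 → 0 < h r := by
    intro r h1 h2
    simp only [hh]
    have : κ * (1 - r) ≤ 1 / 2 := by nlinarith
    nlinarith
  have hk : ∀ r, r₁ ≤ r → r ≤ 1 → 3 / 4 ≤ 1 - M * (r - r₁) ^ 2 := by
    intro r h1 h2
    have e1 : M * (r - r₁) ≤ 1 / 2 := by nlinarith
    have e2 : r - r₁ ≤ 1 / 2 := by linarith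
    nlinarith
  by_contra hcon
  push Not at hcon
  change A * h ‖x₁‖ < _ at hcon
  set ρ₀ := 1 - ε * (3 / 4) with hρ₀
  have hρ0 : ∀ r, r₁ ≤ r → r ≤ 1 → φ r < 1 → r < ρ₀ := by
    intro r h1 h2 h3
    have := hk r h1 h2
    simp only [hφ] at h3
    have := mul_le_mul_of_nonneg_left this hε.le
    linarith
  obtain ⟨z, hz, hzm⟩ := (isCompact_closedBall (0 : EuclideanSpace ℝ (Fin N)) ρ₀).exists_isMaxOn
    ⟨0, by simp; linarith⟩ (hu.contOn fun x hx => lt_of_le_of_lt (b := ρ₀) (by simpa using hx) (by linarith))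
  obtain ⟨ρv, hv0, hv1, hv2⟩ := hv.unif (u z)
  set C : Set (EuclideanSpace ℝ (Fin N) × EuclideanSpace ℝ (Fin N)) :=
    {q | r₁ ≤ ‖q.1‖ ∧ ‖q.1‖ ≤ ρ₀ ∧ ‖q.2‖ = φ ‖q.1‖ ∧ ‖q.2‖ ≤ ρv} with hC
  have hCc : IsCompact C := by
    refine ((isCompact_closedBall (0 : EuclideanSpace ℝ (Fin N)) ρ₀).prod (isCompact_closedBall (0 : EuclideanSpace ℝ (Fin N)) ρv)).of_isClosed_subset ?_ ?_
    · have cφ : Continuous φ := by simp only [hφ]; fun_prop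
      have n1 : Continuous fun q : EuclideanSpace ℝ (Fin N) × EuclideanSpace ℝ (Fin N) => ‖q.1‖ := by fun_prop
      have n2 : Continuous fun q : EuclideanSpace ℝ (Fin N) × EuclideanSpace ℝ (Fin N) => ‖q.2‖ := by fun_prop
      exact (isClosed_le continuous_const n1).inter ((isClosed_le n1 continuous_const).inter
        ((isClosed_eq n2 (cφ.comp n1)).inter (isClosed_le n2 continuous_const)))
    · rintro ⟨x, y⟩ ⟨_, h2, _, h4⟩
      exact ⟨by simpa using h2, by simpa using h4⟩
  have hx1ρ : ‖x₁‖ < ρ₀ := hρ0 _ hx₁ hx₁'.le (by rw [← show ‖y₁‖ = φ ‖x₁‖ from hy₁]; exact hy₁')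
  have hy1v : ‖y₁‖ ≤ ρv := by
    by_contra hc
    push Not at hc
    have e1 := hv2 y₁ hc.le hy₁'
    have e2 : u x₁ ≤ u z := hzm (show x₁ ∈ closedBall 0 ρ₀ by simpa using hx1ρ.le)
    have e3 : 0 ≤ A * h ‖x₁‖ := mul_nonneg hA0 (hhpos _ hx₁ hx₁').le
    linarith
  have hcont : ContinuousOn (fun q : EuclideanSpace ℝ (Fin N) × EuclideanSpace ℝ (Fin N) =>
      (u q.1 - v q.2) / h ‖q.1‖) C := by
    refine ContinuousOn.div (ContinuousOn.sub ?_ ?_) ?_ ?_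
    · exact (hu.contOn (s := {x | ‖x‖ ≤ ρ₀}) fun x hx => lt_of_le_of_lt hx (by linarith)).comp
        continuous_fst.continuousOn fun q hq => hq.2.1
    · exact (hv.contOn (s := {x | ‖x‖ ≤ ρv}) fun x hx => lt_of_le_of_lt hx (by linarith)).comp
        continuous_snd.continuousOn fun q hq => hq.2.2.2
    · simp only [hh]; fun_prop
    · intro q hq
      exact (hhpos _ hq.1 (by linarith [hq.2.1])).ne'
  obtain ⟨⟨x₀, y₀⟩, hq0, hqm⟩ := hCc.exists_isMaxOn ⟨(x₁, y₁), hx₁, hx1ρ.le, hy₁, hy1v⟩ hcont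
  obtain ⟨c1, c2, c3, c4⟩ := hq0
  simp only at c1 c2 c3 c4
  set r := ‖x₀‖ with hr
  have hr1'' : r < 1 := by linarith
  have hhr := hhpos r c1 hr1''
  set A' := (u x₀ - v y₀) / h r with hA'
  have hAA' : A < A' := by
    have e1 : (u x₁ - v y₁) / h ‖x₁‖ ≤ A' := hqm (show (x₁, y₁) ∈ C from ⟨hx₁, hx1ρ.le, hy₁, hy1v⟩)
    have e2 : A < (u x₁ - v y₁) / h ‖x₁‖ := by
      rw [lt_div_iff₀ (hhpos _ hx₁ hx₁')]; exact hcon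
    linarith
  have hAeq : u x₀ - v y₀ = A' * h r := by
    rw [hA', div_mul_cancel₀ _ hhr.ne']
  have hle : ∀ x y, r₁ ≤ ‖x‖ → ‖x‖ ≤ ρ₀ → ‖y‖ = φ ‖x‖ → ‖y‖ ≤ ρv → u x - v y ≤ A' * h ‖x‖ := by
    intro x y d1 d2 d3 d4
    have e1 : (u x - v y) / h ‖x‖ ≤ A' := hqm (show (x, y) ∈ C from ⟨d1, d2, d3, d4⟩)
    rwa [div_le_iff₀ (hhpos _ d1 (by linarith))] at e1
  have hA'0 : 0 < A' := by linarith
  have hy0r : r < ‖y₀‖ := by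
    have := hk r c1 hr1''.le
    rw [c3]; simp only [hφ]
    have := mul_pos hε (show 0 < 1 - M * (r - r₁) ^ 2 by linarith)
    linarith
  have hry : ‖y₀‖ < ρv := by
    refine lt_of_le_of_ne c4 fun hc => ?_
    have e1 := hv2 y₀ hc.ge (by linarith)
    have e2 : u x₀ ≤ u z := hzm (show x₀ ∈ closedBall 0 ρ₀ by simpa using c2)
    have e3 : 0 < A' * h r := mul_pos hA'0 hhr
    linarith
  have hrr : r₁ < r := by
    refine lt_of_le_of_ne c1 fun hc => ?_
    have e1 := hA x₀ hc.symm
    have e2 := hva y₀ (by linarith) (by linarith)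
    have e3 : A * h r₁ < A' * h r := by
      rw [← hc] at hhr ⊢
      exact mul_lt_mul_of_pos_right hAA' hhr
    have e4 : u x₀ - a ≤ A * h r₁ := e1
    linarith
  have hrρ : r < ρ₀ := hρ0 r c1 hr1''.le (by rw [← c3]; linarith)
  have hr0 : 0 < r := by linarith
  have hy0 : 0 < ‖y₀‖ := by linarith
  set ω := r⁻¹ • x₀ with hω
  set ω' := ‖y₀‖⁻¹ • y₀ with hω'
  have hω1 : ‖ω‖ = 1 := by
    rw [hω, norm_smul, norm_inv, Real.norm_of_nonneg hr0.le, ← hr]; field_simp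
  have hω'1 : ‖ω'‖ = 1 := by
    rw [hω', norm_smul, norm_inv, Real.norm_of_nonneg hy0.le]; field_simp
  have hx0 : x₀ = r • ω := by rw [hω, smul_inv_smul₀ hr0.ne']
  have hy0e : y₀ = ‖y₀‖ • ω' := by rw [hω', smul_inv_smul₀ hy0.ne']
  have ha : ∀ x, ‖x‖ = r → u x ≤ u x₀ := by
    intro x hx
    have := hle x y₀ (by linarith) (by linarith) (by rw [hx]; exact c3) c4
    rw [hx] at this
    linarith
  have hb : ∀ y, ‖y‖ = ‖y₀‖ → v y₀ ≤ v y := by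
    intro y hy
    have := hle x₀ y c1 c2 (by rw [hy]; exact c3) (by rw [hy]; exact c4)
    rw [← hr] at this
    linarith
  have hucd := hu.cd (show ‖x₀‖ < 1 from hr1'')
  have hvcd := hv.cd (show ‖y₀‖ < 1 by linarith)
  have T1 := tang_le hr0 hω1 (hx0 ▸ hucd) (fun x hx => by rw [← hx0]; exact ha x hx)
  have T2 := tang_ge hy0 hω'1 (by rw [← hy0e]; exact hvcd) (fun x hx => by rw [← hy0e]; exact hb x hx)
  rw [← hx0, hu.eq hr1''] at T1
  rw [← hy0e, hv.eq (by linarith)] at T2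
  have Hu := (HD2.line x₀ ω).comp_u (x := x₀) (by simp) hucd
  have Hφ := HD2.poly (φ r) (1 - 2 * ε * M * (r - r₁)) (- (ε * M))
  have Hv := (Hφ.smul_const ω').comp_u (x := y₀) (by simp [← c3, ← hy0e]) hvcd
  have Hh := (HD2.poly (h r) (-1 + 2 * κ * (1 - r)) (-κ)).const_mul A'
  have eφ : ∀ t, φ (r + t) = φ r + (1 - 2 * ε * M * (r - r₁)) * t + -(ε * M) * t ^ 2 := by
    intro t; simp only [hφ]; ring
  have eh : ∀ t, h (r + t) = h r + (-1 + 2 * κ * (1 - r)) * t + -κ * t ^ 2 := by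
    intro t; simp only [hh]; ring
  have Hall := ((Hu.sub Hv).sub Hh).const_mul (-1)
  have nline : ∀ t : ℝ, -r < t → ‖x₀ + t • ω‖ = r + t := by
    intro t ht
    have : x₀ + t • ω = (r + t) • ω := by rw [add_smul, ← hx0]
    rw [this, norm_smul, hω1, Real.norm_of_nonneg (by linarith), mul_one]
  have hmin := Hall.nonneg_of_min (by
    have ct : Continuous (fun t : ℝ => φ (r + t)) := by simp only [hφ]; fun_prop
    have ev1 : ∀ᶠ t : ℝ in 𝓝 0, φ (r + t) < ρv := by
      refine (ct.tendsto 0).eventually_lt_const ?_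
      rw [add_zero, ← c3]; exact hry
    have ev2 : ∀ᶠ t : ℝ in 𝓝 0, 0 < φ (r + t) := by
      refine (ct.tendsto 0).eventually_const_lt ?_
      rw [add_zero, ← c3]; exact hy0
    have ev3 : ∀ᶠ t : ℝ in 𝓝 0, t ∈ Ioo (r₁ - r) (ρ₀ - r) :=
      isOpen_Ioo.mem_nhds ⟨by linarith, by linarith⟩
    filter_upwards [ev1, ev2, ev3] with t t1 t2 t3
    have n1 := nline t (by linarith [t3.1])
    have := hle (x₀ + t • ω) (φ (r + t) • ω') (by rw [n1]; linarith [t3.1]) (by rw [n1]; linarith [t3.2])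
      (by rw [n1, norm_smul, hω'1, Real.norm_of_nonneg t2.le, mul_one])
      (by rw [norm_smul, hω'1, Real.norm_of_nonneg t2.le, mul_one]; exact t1.le)
    rw [n1, eφ, eh] at this
    have e0 : φ r • ω' = y₀ := by rw [← c3, ← hy0e]
    simp only [zero_smul, add_zero, mul_zero, ne_eq, OfNat.ofNat_ne_zero, not_false_eq_true, zero_pow, e0]
    linarith)
  have hpu : 0 ≤ fderiv ℝ u x₀ ω := by
    obtain ⟨g', i1, i2, i3⟩ := Hu
    have i4 := i1.self_of_nhds
    rw [i2] at i4
    refine deriv_nonneg_of_left i4 ?_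
    have : ∀ᶠ t : ℝ in 𝓝[<] 0, -r < t := nhdsWithin_le_nhds (lt_mem_nhds (by linarith))
    filter_upwards [this, self_mem_nhdsWithin] with t t1 (t2 : t < 0)
    obtain ⟨y, y1, y2⟩ := hmono r c1 hr1'' (x₀ + t • ω) (by rw [nline t t1]; linarith)
    simp only [zero_smul, add_zero]
    exact y2.trans (ha y y1)
  obtain ⟨m1, m2⟩ := hmin
  simp only [D2_smul, map_smul, smul_eq_mul, map_zero, add_zero] at m1 m2
  have hv0a := hva y₀ (by linarith) (by linarith)
  have hKK := hKf (v y₀) (u x₀) (by have := mul_pos hA'0 hhr; linarith)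
  rw [hAeq] at hKK
  refine alg_double (n := n) (K := K) (κ := κ) (M := M) (ε := ε) (s := r - r₁) (k := 1 - M * (r - r₁) ^ 2) (r := r)
    (ρ := ‖y₀‖) (φ' := 1 - 2 * ε * M * (r - r₁)) (pu := fderiv ℝ u x₀ ω) (pv := fderiv ℝ v y₀ ω')
    (qu := D2 u x₀ ω) (qv := D2 v y₀ ω') (h := h r) (h' := -1 + 2 * κ * (1 - r)) (A := A')
    (fu := f (u x₀)) (fv := f (v y₀)) hn0 hK hκ hM hε hε1 (by linarith) ?_ ?_ ?_ (by linarith) hr1''.le c3 rfl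
    ?_ ?_ hA'0 hpu (by linarith) (by linarith) (by rw [hn]; exact T1) (by rw [hn]; exact T2) hKK (hf0 _ hv0a)
  · have := mul_le_mul_of_nonneg_left (show r - r₁ ≤ 1 - r₁ by linarith) (show 0 ≤ 2 * M by linarith)
    linarith
  · have := hk r c1 hr1''.le; linarith
  · have : 0 ≤ M * (r - r₁) ^ 2 := by positivity
    linarith
  · simp only [hh]
    have : 0 ≤ κ * (1 - r) ^ 2 := by positivity
    linarith
  · have := mul_le_mul_of_nonneg_left (show 1 - r ≤ 1 - r₁ by linarith) (show 0 ≤ 2 * κ by linarith)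
    linarith

lemma double_cmp {N : ℕ} {f : ℝ → ℝ} {u v : EuclideanSpace ℝ (Fin N) → ℝ} (hu : IsBlowUp f u)
    (hv : IsBlowUp f v) (hN : 1 ≤ N) {a K : ℝ} (hf0 : ∀ t > a, 0 ≤ f t)
    (hK : 0 ≤ K) (hKf : ∀ s t, s ≤ t → f s - f t ≤ K * (t - s)) :
    ∃ r₁ A : ℝ, 0 < r₁ ∧ r₁ < 1 ∧ 0 ≤ A ∧ ∀ x y, r₁ ≤ ‖x‖ → ‖x‖ < 1 → ‖y‖ = ‖x‖ →
      u x - v y ≤ A * (1 - ‖x‖) := by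
  have hn0 : (0:ℝ) ≤ (N:ℝ) - 1 := by
    have : (1:ℝ) ≤ N := by exact_mod_cast hN
    linarith
  obtain ⟨ra, a0, a1, a2⟩ := hu.mono hN hf0
  obtain ⟨rb, b0, b1, b2⟩ := hv.unif a
  set M : ℝ := 4 * ((N:ℝ) - 1) + 1 with hM
  set κ : ℝ := K + 1 with hκ
  have hM1 : 1 ≤ M := by linarith
  have hκ1 : 1 ≤ κ := by linarith
  obtain ⟨r₁, hr⟩ : ∃ r₁ : ℝ, r₁ = max (max ra rb) (max (1 - 1 / (2 * M)) (1 - 1 / (2 * κ))) := ⟨_, rfl⟩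
  have i1 : ra ≤ r₁ := by rw [hr]; simp
  have i2 : rb ≤ r₁ := by rw [hr]; simp
  have i3 : 1 - 1 / (2 * M) ≤ r₁ := by rw [hr]; simp
  have i4 : 1 - 1 / (2 * κ) ≤ r₁ := by rw [hr]; simp
  have i5 : r₁ < 1 := by
    rw [hr]
    have : 0 < 1 / (2 * M) := by positivity
    have : 0 < 1 / (2 * κ) := by positivity
    refine max_lt (max_lt a1 b1) (max_lt ?_ ?_) <;> linarith
  have i6 : 1 / 2 ≤ r₁ := by
    have : 1 / (2 * M) ≤ 1 / 2 := by
      apply one_div_le_one_div_of_le <;> linarith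
    linarith
  have i7 : 2 * M * (1 - r₁) ≤ 1 := by
    have : 1 - r₁ ≤ 1 / (2 * M) := by linarith
    rw [le_div_iff₀ (by positivity)] at this
    linarith
  have i8 : 2 * κ * (1 - r₁) ≤ 1 := by
    have : 1 - r₁ ≤ 1 / (2 * κ) := by linarith
    rw [le_div_iff₀ (by positivity)] at this
    linarith
  obtain ⟨z, hz, hzm⟩ := (isCompact_closedBall (0 : EuclideanSpace ℝ (Fin N)) r₁).exists_isMaxOn
    ⟨0, by simp; linarith⟩ (hu.contOn fun x hx => lt_of_le_of_lt (by simpa using hx) i5)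
  have hh1 : 0 < (1 - r₁) - κ * (1 - r₁) ^ 2 := by
    have : κ * (1 - r₁) ≤ 1 / 2 := by linarith
    nlinarith
  set A := max (u z - a) 0 / ((1 - r₁) - κ * (1 - r₁) ^ 2) with hA
  have hA0 : 0 ≤ A := by rw [hA]; positivity
  have hA1 : ∀ x, ‖x‖ = r₁ → u x - a ≤ A * ((1 - r₁) - κ * (1 - r₁) ^ 2) := by
    intro x hx
    rw [hA, div_mul_cancel₀ _ hh1.ne']
    have : u x ≤ u z := hzm (show x ∈ closedBall 0 r₁ by simpa using hx.le)
    exact le_max_of_le_left (by linarith)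
  refine ⟨r₁, A, by linarith, i5, hA0, fun x y hx hx1 hxy => ?_⟩
  have hx0 : 0 < ‖x‖ := by linarith
  have key : ∀ᶠ ε : ℝ in 𝓝[>] 0, u x - v (((‖x‖ + ε * (1 - M * (‖x‖ - r₁) ^ 2)) / ‖x‖) • y) ≤ A * (1 - ‖x‖) := by
    have c : Continuous fun ε : ℝ => ‖x‖ + ε * (1 - M * (‖x‖ - r₁) ^ 2) := by fun_prop
    have e1 : ∀ᶠ ε : ℝ in 𝓝[>] 0, ‖x‖ + ε * (1 - M * (‖x‖ - r₁) ^ 2) < 1 :=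
      nhdsWithin_le_nhds ((c.tendsto 0).eventually_lt_const (by simpa using hx1))
    have e2 : ∀ᶠ ε : ℝ in 𝓝[>] 0, 0 < ‖x‖ + ε * (1 - M * (‖x‖ - r₁) ^ 2) :=
      nhdsWithin_le_nhds ((c.tendsto 0).eventually_const_lt (by simpa using hx0))
    have e3 : ∀ᶠ ε : ℝ in 𝓝[>] 0, ε < 1 := nhdsWithin_le_nhds (gt_mem_nhds (by norm_num))
    filter_upwards [e1, e2, e3, self_mem_nhdsWithin] with ε t1 t2 t3 (t4 : 0 < ε)
    have hy : ‖((‖x‖ + ε * (1 - M * (‖x‖ - r₁) ^ 2)) / ‖x‖) • y‖ = ‖x‖ + ε * (1 - M * (‖x‖ - r₁) ^ 2) := by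
      rw [norm_smul, hxy, Real.norm_of_nonneg (by positivity), div_mul_cancel₀ _ hx0.ne']
    have := double_eps hu hv hN hf0 hK hKf rfl hκ hM i6 i5 i7 i8
      (fun s hs => a2 s (by linarith)) (fun x hx => b2 x (by linarith)) hA0 hA1 t4 t3 x _ hx hx1 hy (by rw [hy]; exact t1)
    refine this.trans (mul_le_mul_of_nonneg_left ?_ hA0)
    have : 0 ≤ κ * (1 - ‖x‖) ^ 2 := by positivity
    linarith
  have hlim : Tendsto (fun ε : ℝ => u x - v (((‖x‖ + ε * (1 - M * (‖x‖ - r₁) ^ 2)) / ‖x‖) • y)) (𝓝[>] 0) (𝓝 (u x - v y)) := by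
    have hvc : ContinuousAt v y := (hv.cd (by rw [hxy]; exact hx1)).continuousAt
    have c : Continuous fun ε : ℝ => ((‖x‖ + ε * (1 - M * (‖x‖ - r₁) ^ 2)) / ‖x‖) • y := by fun_prop
    have c1 := c.tendsto 0
    simp only [zero_mul, add_zero, div_self hx0.ne', one_smul] at c1
    exact (tendsto_const_nhds.sub (hvc.tendsto.comp c1)).mono_left nhdsWithin_le_nhds
  exact le_of_tendsto hlim key
noncomputable def rfl' {N : ℕ} (e : EuclideanSpace ℝ (Fin N)) (l : ℝ) (x : EuclideanSpace ℝ (Fin N)) :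
    EuclideanSpace ℝ (Fin N) := x + (2 * (l - inner ℝ e x)) • e

lemma rfl'_normsq {N : ℕ} {e : EuclideanSpace ℝ (Fin N)} (he : ‖e‖ = 1) (l : ℝ)
    (x : EuclideanSpace ℝ (Fin N)) : ‖rfl' e l x‖ ^ 2 = ‖x‖ ^ 2 + 4 * l * (l - inner ℝ e x) := by
  rw [rfl', inner_line_sq _ _ he, real_inner_comm]
  ring

lemma rfl'_norm_le {N : ℕ} {e : EuclideanSpace ℝ (Fin N)} (he : ‖e‖ = 1) {l : ℝ} (hl : 0 ≤ l)
    {x : EuclideanSpace ℝ (Fin N)} (hx : l ≤ inner ℝ e x) : ‖rfl' e l x‖ ≤ ‖x‖ := by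
  rw [← sq_le_sq₀ (norm_nonneg _) (norm_nonneg _), rfl'_normsq he]
  nlinarith

lemma mp_refl {N : ℕ} {f : ℝ → ℝ} {u : EuclideanSpace ℝ (Fin N) → ℝ} (hu : IsBlowUp f u)
    {b : OrthonormalBasis (Fin N) ℝ (EuclideanSpace ℝ (Fin N))} {i₀ : Fin N} {l : ℝ}
    {x : EuclideanSpace ℝ (Fin N)} (hx : ‖x‖ < 1) (hx' : ‖rfl' (b i₀) l x‖ < 1)
    {g : EuclideanSpace ℝ (Fin N) → ℝ} {p q : Fin N → ℝ}
    (hg : ∀ i, HD2 (fun t : ℝ => g (x + t • b i)) (p i) (q i))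
    (hmin : IsLocalMin (fun z => u z - u (rfl' (b i₀) l z) - g z) x) :
    ∑ i, q i ≤ f (u x) - f (u (rfl' (b i₀) l x)) := by
  have hcd := hu.cd hx
  have hcd' := hu.cd hx'
  rw [← hu.eq hx, ← hu.eq hx', ← lap_eq_basis hcd b, ← lap_eq_basis hcd' b, ← Finset.sum_sub_distrib]
  refine Finset.sum_le_sum fun i _ => ?_
  obtain ⟨σ, hσ, hline⟩ : ∃ σ : ℝ, σ ^ 2 = 1 ∧ ∀ t : ℝ, rfl' (b i₀) l (x + t • b i) = rfl' (b i₀) l x + t • σ • b i := by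
    by_cases hi : i = i₀
    · refine ⟨-1, by norm_num, fun t => ?_⟩
      subst hi
      have : inner ℝ (b i) (b i) = (1:ℝ) := by
        rw [real_inner_self_eq_norm_sq, b.orthonormal.1 i]; norm_num
      simp only [rfl', inner_add_right, inner_smul_right, this]
      module
    · refine ⟨1, by norm_num, fun t => ?_⟩
      have : inner ℝ (b i₀) (b i) = (0:ℝ) := b.orthonormal.2 (Ne.symm hi)
      simp only [rfl', inner_add_right, inner_smul_right, this]
      module
  have h1 := (HD2.line x (b i)).comp_u (x := x) (by simp) hcd
  have h2 := (HD2.line (rfl' (b i₀) l x) (σ • b i)).comp_u (x := rfl' (b i₀) l x) (by simp) hcd'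
  have h3 := ((h1.sub h2).sub (hg i)).nonneg_of_min ?_
  · have := h3.2
    simp only [D2_smul, hσ, map_zero] at this
    linarith
  · have := (tendsto_line x (b i)).eventually hmin
    filter_upwards [this] with t ht
    simp only [hline] at ht
    simpa using ht

lemma basis_inner {N : ℕ} (b : OrthonormalBasis (Fin N) ℝ (EuclideanSpace ℝ (Fin N))) (i₀ i : Fin N) :
    inner ℝ (b i₀) (b i) = if i₀ = i then (1:ℝ) else 0 :=
  orthonormal_iff_ite.1 b.orthonormal i₀ i

lemma basis_normsq {N : ℕ} (b : OrthonormalBasis (Fin N) ℝ (EuclideanSpace ℝ (Fin N)))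
    (x : EuclideanSpace ℝ (Fin N)) : ∑ i, (inner ℝ x (b i)) ^ 2 = ‖x‖ ^ 2 := by
  rw [← real_inner_self_eq_norm_sq, ← b.sum_inner_mul_inner x x]
  refine Finset.sum_congr rfl fun i _ => ?_
  rw [real_inner_comm x (b i)]; ring

/-- second derivatives of the Gaussian-type function. -/
lemma HD2.gauss {N : ℕ} (x y v : EuclideanSpace ℝ (Fin N)) (hv : ‖v‖ = 1) (γ c : ℝ) :
    HD2 (fun t : ℝ => Real.exp (γ * (‖x + t • v - y‖ ^ 2 - c)))
      (Real.exp (γ * (‖x - y‖ ^ 2 - c)) * (2 * γ * inner ℝ (x - y) v))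
      (Real.exp (γ * (‖x - y‖ ^ 2 - c)) * ((2 * γ * inner ℝ (x - y) v) ^ 2 + 2 * γ)) := by
  refine (HD2.poly (γ * (‖x - y‖ ^ 2 - c)) (2 * γ * inner ℝ (x - y) v) γ).exp.congr ?_ ?_ ?_
  · intro t
    have : x + t • v - y = (x - y) + t • v := by abel
    rw [this, inner_line_sq _ _ hv]
    congr 1; ring
  · simp
  · simp

lemma gauss_sum {N : ℕ} (b : OrthonormalBasis (Fin N) ℝ (EuclideanSpace ℝ (Fin N)))
    (z : EuclideanSpace ℝ (Fin N)) (E γ : ℝ) :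
    ∑ i, E * ((2 * γ * inner ℝ z (b i)) ^ 2 + 2 * γ) = E * (4 * γ ^ 2 * ‖z‖ ^ 2 + 2 * γ * N) := by
  rw [← Finset.mul_sum, Finset.sum_add_distrib, ← basis_normsq b z, Finset.mul_sum]
  congr 1
  congr 1
  · exact Finset.sum_congr rfl fun i _ => by ring
  · simp; ring

set_option maxHeartbeats 2000000 in
lemma narrow {N : ℕ} {f : ℝ → ℝ} {u : EuclideanSpace ℝ (Fin N) → ℝ} (hu : IsBlowUp f u)
    {K L : ℝ} (hK : 0 ≤ K) (hL : L = K + 1) (hKf : ∀ s t, s ≤ t → f s - f t ≤ K * (t - s))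
    {r₁ A : ℝ} (hr₁ : r₁ < 1) (hA : 0 ≤ A)
    (hbd : ∀ x y, r₁ ≤ ‖x‖ → ‖x‖ < 1 → ‖y‖ ≤ ‖x‖ → - (A * (1 - ‖x‖)) ≤ u x - u y)
    {e : EuclideanSpace ℝ (Fin N)} (he : ‖e‖ = 1) {l t₀ : ℝ} (hl : 0 ≤ l) (ht₀ : t₀ ≤ l + 1 / (16 * L))
    (hcore : ∀ x, t₀ ≤ inner ℝ e x → l < inner ℝ e x → ‖x‖ ≤ 1 - 1 / (32 * L) → u (rfl' e l x) ≤ u x) :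
    ∀ x, ‖x‖ < 1 → l < inner ℝ e x → u (rfl' e l x) ≤ u x := by
  obtain ⟨b, i₀, rfl⟩ := exists_basis e he
  intro x₁ hx₁ hlx₁
  by_contra hcon
  push Not at hcon
  have hL1 : 1 ≤ L := by linarith
  set ρ := 1 - 1 / (32 * L) with hρ
  have hρ1 : 1 / (32 * L) ≤ 1 / 32 := by
    apply one_div_le_one_div_of_le <;> linarith
  have hρ2 : 0 < 1 / (32 * L) := by positivity
  set E₁ : EuclideanSpace ℝ (Fin N) → ℝ := fun x => Real.exp (- (16 * L) * (inner ℝ (b i₀) x - t₀)) with hE₁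
  set E₂ : EuclideanSpace ℝ (Fin N) → ℝ := fun x => Real.exp ((16 * L) * (‖x - 0‖ ^ 2 - ρ ^ 2)) with hE₂
  set φ : EuclideanSpace ℝ (Fin N) → ℝ := fun x => 1 - (1 / 16) * E₁ x - (1 / 16) * E₂ x with hφ
  have hφc : Continuous φ := by simp only [hφ, hE₁, hE₂]; fun_prop
  have hexp1 : Real.exp 1 < 3 := by have := Real.exp_one_lt_d9; linarith
  have hφ1 : ∀ x, φ x ≤ 1 := by
    intro x
    simp only [hφ]
    have h1 : 0 < E₁ x := Real.exp_pos _
    have h2 : 0 < E₂ x := Real.exp_pos _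
    linarith
  have hφ0 : ∀ x, l ≤ inner ℝ (b i₀) x → ‖x‖ ≤ 1 → 1 / 2 ≤ φ x := by
    intro x h1 h2
    have h3 : E₁ x ≤ Real.exp 1 := by
      apply Real.exp_le_exp.2
      have : t₀ - inner ℝ (b i₀) x ≤ 1 / (16 * L) := by linarith
      rw [le_div_iff₀ (by positivity)] at this
      linarith
    have h4 : E₂ x ≤ Real.exp 1 := by
      apply Real.exp_le_exp.2
      rw [sub_zero]
      have e1 : ‖x‖ ^ 2 ≤ 1 := by have := norm_nonneg x; nlinarith
      have e2 : 1 - ρ ^ 2 ≤ 1 / (16 * L) := by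
        have e3 : 1 / (16 * L) = 2 * (1 / (32 * L)) := by field_simp; norm_num
        rw [e3, hρ]
        nlinarith
      have : ‖x‖ ^ 2 - ρ ^ 2 ≤ 1 / (16 * L) := by linarith
      rw [le_div_iff₀ (by positivity)] at this
      linarith
    simp only [hφ]
    linarith
  set w : EuclideanSpace ℝ (Fin N) → ℝ := fun x => u x - u (rfl' (b i₀) l x) with hw
  have hw1 : w x₁ < 0 := by simp only [hw]; linarith
  -- choose the compact set
  obtain ⟨ρc, hρc1, hρc2, hρc3⟩ : ∃ ρc, r₁ ≤ ρc ∧ ρc < 1 ∧ A * (1 - ρc) < - w x₁ / 4 := by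
    have hlim : Tendsto (fun ρ : ℝ => A * (1 - ρ)) (𝓝[<] 1) (𝓝 0) := by
      have : Continuous fun ρ : ℝ => A * (1 - ρ) := by fun_prop
      have := this.tendsto 1
      simp only [sub_self, mul_zero] at this
      exact this.mono_left nhdsWithin_le_nhds
    have h1 := hlim.eventually_lt_const (show 0 < - w x₁ / 4 by linarith)
    have h2 : ∀ᶠ ρ : ℝ in 𝓝[<] 1, r₁ ≤ ρ := nhdsWithin_le_nhds (Ici_mem_nhds hr₁)
    obtain ⟨ρ, a1, a2, a3⟩ := (h1.and (h2.and (self_mem_nhdsWithin (s := Iio (1:ℝ))))).exists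
    exact ⟨ρ, a2, a3, a1⟩
  have hwb : ∀ x, ρc ≤ ‖x‖ → ‖x‖ < 1 → l ≤ inner ℝ (b i₀) x → w x₁ / 4 < w x := by
    intro x h1 h2 h3
    have := hbd x _ (by linarith) h2 (rfl'_norm_le he hl h3)
    have h4 : A * (1 - ‖x‖) ≤ A * (1 - ρc) := by gcongr
    simp only [hw] at *
    linarith
  set T : Set (EuclideanSpace ℝ (Fin N)) := {x | l ≤ inner ℝ (b i₀) x ∧ ‖x‖ ≤ ρc} with hT
  have hTc : IsCompact T := by
    refine (isCompact_closedBall (0 : EuclideanSpace ℝ (Fin N)) ρc).of_isClosed_subset ?_ ?_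
    · have ci : Continuous fun x : EuclideanSpace ℝ (Fin N) => inner ℝ (b i₀) x := by fun_prop
      exact (isClosed_le continuous_const ci).inter (isClosed_le continuous_norm continuous_const)
    · intro x hx; simpa using hx.2
  have hwc : ContinuousOn w T := by
    refine (hu.contOn fun x hx => lt_of_le_of_lt hx.2 hρc2).sub ?_
    refine (hu.contOn (s := ball 0 1) fun x hx => by simpa using hx).comp ?_ ?_
    · unfold rfl'; fun_prop
    · intro x hx
      simpa using lt_of_le_of_lt (rfl'_norm_le he hl hx.1) (lt_of_le_of_lt hx.2 hρc2)
  have hφT : ∀ x ∈ T, 1 / 2 ≤ φ x := fun x hx => hφ0 x hx.1 (by linarith [hx.2])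
  have hx₁T : x₁ ∈ T := by
    refine ⟨hlx₁.le, ?_⟩
    by_contra hc
    push Not at hc
    have := hwb x₁ hc.le hx₁ hlx₁.le
    linarith
  obtain ⟨z, hz, hzm⟩ := hTc.exists_isMinOn ⟨x₁, hx₁T⟩
    (hwc.div hφc.continuousOn fun x hx => by have := hφT x hx; linarith)
  have hφz := hφT z hz
  set μ := w z / φ z with hμ
  have hμle : ∀ x ∈ T, μ * φ x ≤ w x := by
    intro x hx
    have h1 : μ ≤ w x / φ x := hzm hx
    have h2 := hφT x hx
    rwa [le_div_iff₀ (by linarith)] at h1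
  have hμz : w z = μ * φ z := by rw [hμ, div_mul_cancel₀ _ (by linarith)]
  have hμ1 : μ ≤ w x₁ := by
    have h1 := hμle x₁ hx₁T
    have h2 := hφT x₁ hx₁T
    have h3 := hφ1 x₁
    by_contra hc
    push Not at hc
    rcases le_or_gt 0 μ with h | h
    · have := mul_nonneg h (show 0 ≤ φ x₁ by linarith)
      linarith
    · nlinarith
  have hμ0 : μ < 0 := by linarith
  have hwz : w z ≤ w x₁ / 2 := by rw [hμz]; nlinarith
  have hzρ : ‖z‖ < ρc := by
    refine lt_of_le_of_ne hz.2 fun hc => ?_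
    have := hwb z hc.ge (by linarith) hz.1
    linarith
  have hzl : l < inner ℝ (b i₀) z := by
    refine lt_of_le_of_ne hz.1 fun hc => ?_
    have : w z = 0 := by simp [hw, rfl', ← hc]
    linarith
  have hmin : IsLocalMin (fun x => u x - u (rfl' (b i₀) l x) - μ * φ x) z := by
    have o1 : ∀ᶠ x in 𝓝 z, l < inner ℝ (b i₀) x :=
      (isOpen_lt continuous_const (by fun_prop)).mem_nhds hzl
    have o2 : ∀ᶠ x in 𝓝 z, ‖x‖ < ρc :=
      (isOpen_lt continuous_norm continuous_const).mem_nhds hzρ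
    filter_upwards [o1, o2] with x x1 x2
    have h1 := hμle x ⟨x1.le, x2.le⟩
    simp only [hw] at h1 hμz
    linarith
  have hg : ∀ i, HD2 (fun t : ℝ => μ * φ (z + t • b i)) _ _ := fun i => by
    have g1 : HD2 (fun t : ℝ => E₁ (z + t • b i)) (E₁ z * (-(16 * L) * inner ℝ (b i₀) (b i)))
        (E₁ z * ((-(16 * L) * inner ℝ (b i₀) (b i)) ^ 2)) := by
      refine (HD2.poly (-(16 * L) * (inner ℝ (b i₀) z - t₀)) (-(16 * L) * inner ℝ (b i₀) (b i)) 0).exp.congr ?_ ?_ ?_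
      · intro t
        simp only [hE₁, inner_add_right, inner_smul_right]
        congr 1; ring
      · simp [hE₁]
      · simp [hE₁]
    have g2 := HD2.gauss z 0 (b i) (b.orthonormal.1 i) (16 * L) (ρ ^ 2)
    exact (((HD2.const (1:ℝ)).sub (g1.const_mul (1/16))).sub (g2.const_mul (1/16))).const_mul μ
  have hfin := mp_refl hu (by linarith) (lt_of_le_of_lt (rfl'_norm_le he hl hz.1) (by linarith)) hg hmin
  rw [← Finset.mul_sum, Finset.sum_sub_distrib, Finset.sum_sub_distrib, ← Finset.mul_sum, ← Finset.mul_sum,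
    ← Finset.mul_sum, gauss_sum] at hfin
  have hs1 : ∑ i, (-(16 * L) * inner ℝ (b i₀) (b i)) ^ 2 = (16 * L) ^ 2 := by
    simp_rw [basis_inner]
    simp
  rw [hs1] at hfin
  have hfK := hKf (u z) (u (rfl' (b i₀) l z)) (by simp only [hw] at hwz hw1; linarith)
  have hwz' : u (rfl' (b i₀) l z) - u z = (-μ) * φ z := by
    simp only [hw] at hμz; linarith
  rw [hwz'] at hfK
  have hE1p : 0 < E₁ z := Real.exp_pos _
  have hE2p : 0 < E₂ z := Real.exp_pos _
  have hsum : L ≤ 1 / 16 * (E₁ z * (16 * L) ^ 2) + 1 / 16 * (E₂ z * (4 * (16 * L) ^ 2 * ‖z - 0‖ ^ 2 + 2 * (16 * L) * N)) := by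
    have p1 : 0 ≤ 1 / 16 * (E₁ z * (16 * L) ^ 2) := by positivity
    have p2 : 0 ≤ 1 / 16 * (E₂ z * (4 * (16 * L) ^ 2 * ‖z - 0‖ ^ 2 + 2 * (16 * L) * N)) := by positivity
    have hLL : L ≤ L ^ 2 := by nlinarith
    by_cases hcase : t₀ ≤ inner ℝ (b i₀) z
    · have hzρ' : ρ < ‖z‖ := by
        by_contra hc
        push Not at hc
        have := hcore z hcase hzl hc
        simp only [hw] at hwz hw1
        linarith
      have q1 : 1 ≤ E₂ z := by
        apply Real.one_le_exp
        rw [sub_zero]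
        have : ρ ^ 2 ≤ ‖z‖ ^ 2 := by
          apply pow_le_pow_left₀ _ hzρ'.le
          linarith
        apply mul_nonneg (by linarith); linarith
      have q2 : 1 / 4 ≤ ‖z - 0‖ ^ 2 := by
        rw [sub_zero]
        have : 1 / 2 ≤ ‖z‖ := by linarith
        nlinarith
      have q3 : (16 * L) ^ 2 ≤ 4 * (16 * L) ^ 2 * ‖z - 0‖ ^ 2 + 2 * (16 * L) * N := by
        have h0 : 0 ≤ 2 * (16 * L) * (N:ℝ) := by positivity
        have h1 := mul_le_mul_of_nonneg_left q2 (show 0 ≤ 4 * (16 * L) ^ 2 by positivity)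
        linarith
      have q4 : 1 * (16 * L) ^ 2 ≤ E₂ z * (4 * (16 * L) ^ 2 * ‖z - 0‖ ^ 2 + 2 * (16 * L) * N) :=
        mul_le_mul q1 q3 (by positivity) hE2p.le
      have q5 : (16 * L) ^ 2 = 256 * L ^ 2 := by ring
      linarith
    · have q1 : 1 ≤ E₁ z := by
        apply Real.one_le_exp
        push Not at hcase
        have h0 := mul_nonneg (show 0 ≤ 16 * L by linarith) (sub_nonneg.2 hcase.le)
        linarith
      have q4 : 1 * (16 * L) ^ 2 ≤ E₁ z * (16 * L) ^ 2 :=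
        mul_le_mul_of_nonneg_right q1 (by positivity)
      have q5 : (16 * L) ^ 2 = 256 * L ^ 2 := by ring
      linarith
  have h9 : (-μ) * L ≤ K * (-μ * φ z) := by
    have h10 := mul_le_mul_of_nonneg_left hsum (show 0 ≤ -μ by linarith)
    simp only [Finset.sum_const_zero] at hfin
    refine le_trans h10 (le_trans (le_of_eq ?_) (hfin.trans hfK))
    simp only [hE₂]
    ring
  have h11 : K * (-μ * φ z) ≤ K * (-μ) := by
    apply mul_le_mul_of_nonneg_left _ hK
    have := hφ1 z
    nlinarith
  rw [hL] at h9
  nlinarith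
lemma hbd_lem {N : ℕ} {f : ℝ → ℝ} {u : EuclideanSpace ℝ (Fin N) → ℝ} (hu : IsBlowUp f u)
    (hN : 1 ≤ N) {a K : ℝ} (hf0 : ∀ t > a, 0 ≤ f t)
    (hK : 0 ≤ K) (hKf : ∀ s t, s ≤ t → f s - f t ≤ K * (t - s)) :
    ∃ r₁ A : ℝ, r₁ < 1 ∧ 0 ≤ A ∧
      ∀ x y, r₁ ≤ ‖x‖ → ‖x‖ < 1 → ‖y‖ ≤ ‖x‖ → - (A * (1 - ‖x‖)) ≤ u x - u y := by
  obtain ⟨r, h0, h1, h2⟩ := hu.mono hN hf0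
  obtain ⟨r', A, k0, k1, k2, k3⟩ := double_cmp hu hu hN hf0 hK hKf
  refine ⟨max r r', A, max_lt h1 k1, k2, fun x y hx hx1 hy => ?_⟩
  obtain ⟨y', hy', hyy⟩ := h2 ‖x‖ (le_trans (le_max_left _ _) hx) hx1 y hy
  have := k3 y' x (by rw [hy']; exact le_trans (le_max_right _ _) hx) (by rw [hy']; exact hx1) hy'.symm
  rw [hy'] at this
  linarith

lemma smp_local {N : ℕ} {f : ℝ → ℝ} {u : EuclideanSpace ℝ (Fin N) → ℝ} (hu : IsBlowUp f u)
    (hf : ContDiff ℝ 1 f) {e : EuclideanSpace ℝ (Fin N)} (he : ‖e‖ = 1) {l : ℝ} (hl : 0 ≤ l)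
    (hw0 : ∀ x, ‖x‖ < 1 → l < inner ℝ e x → u (rfl' e l x) ≤ u x)
    {y : EuclideanSpace ℝ (Fin N)} {ρ : ℝ} (hρ : 0 < ρ)
    (hy : ∀ x, ‖x - y‖ ≤ ρ → ‖x‖ < 1 ∧ l < inner ℝ e x)
    (hyp : u (rfl' e l y) < u y) : ∀ x, ‖x - y‖ < ρ → u (rfl' e l x) < u x := by
  obtain ⟨b, i₀, rfl⟩ := exists_basis e he
  intro x₁ hx₁
  by_contra hcon
  push Not at hcon
  set w : EuclideanSpace ℝ (Fin N) → ℝ := fun x => u x - u (rfl' (b i₀) l x) with hw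
  have hw1 : w x₁ ≤ 0 := by simp only [hw]; linarith
  have hrf : ∀ x ∈ closedBall y ρ, ‖rfl' (b i₀) l x‖ < 1 := by
    intro x hx
    rw [mem_closedBall_iff_norm] at hx
    exact lt_of_le_of_lt (rfl'_norm_le he hl (hy x hx).2.le) (hy x hx).1
  have huc : ContinuousOn u (closedBall y ρ) := hu.contOn fun x hx =>
    (hy x (by rwa [mem_closedBall_iff_norm] at hx)).1
  have hrc : ContinuousOn (fun x => u (rfl' (b i₀) l x)) (closedBall y ρ) := by
    refine (hu.contOn (s := ball 0 1) fun x hx => by simpa using hx).comp ?_ ?_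
    · unfold rfl'; fun_prop
    · intro x hx
      simpa using hrf x hx
  have hwc : ContinuousOn w (closedBall y ρ) := huc.sub hrc
  have hcB := isCompact_closedBall y ρ
  obtain ⟨M, hM⟩ : ∃ M : NNReal, LipschitzOnWith M f (u '' closedBall y ρ ∪ (fun x => u (rfl' (b i₀) l x)) '' closedBall y ρ) :=
    LocallyLipschitzOn.exists_lipschitzOnWith_of_compact
      ((hcB.image_of_continuousOn huc).union (hcB.image_of_continuousOn hrc))
      (hf.locallyLipschitz.locallyLipschitzOn)
  obtain ⟨δ, hδ0, hδ1, hδρ, hδ⟩ : ∃ δ, 0 < δ ∧ δ < 1 ∧ δ < ρ ∧ ∀ x, ‖x - y‖ ≤ δ → 0 < w x := by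
    have hca : ContinuousAt w y := hwc.continuousAt (closedBall_mem_nhds y hρ)
    have := hca.eventually_const_lt (show 0 < w y by simp only [hw]; linarith)
    obtain ⟨δ', h1, h2⟩ := Metric.eventually_nhds_iff.1 this
    refine ⟨min (min 1 ρ) δ' / 2, by positivity, ?_, ?_, ?_⟩
    · have : min (min 1 ρ) δ' ≤ 1 := le_trans (min_le_left _ _) (min_le_left _ _)
      linarith
    · have : min (min 1 ρ) δ' ≤ ρ := le_trans (min_le_left _ _) (min_le_right _ _)
      linarith
    · intro x hx
      apply h2
      rw [dist_eq_norm]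
      have : min (min 1 ρ) δ' ≤ δ' := min_le_right _ _
      linarith
  obtain ⟨m, hm0, hm⟩ : ∃ m, 0 < m ∧ ∀ x, ‖x - y‖ ≤ δ → m ≤ w x := by
    obtain ⟨z, hz, hzm⟩ := (isCompact_closedBall y δ).exists_isMinOn ⟨y, mem_closedBall_self hδ0.le⟩
      (hwc.mono (closedBall_subset_closedBall hδρ.le))
    refine ⟨w z, hδ z (by rwa [mem_closedBall_iff_norm] at hz), fun x hx => hzm ?_⟩
    rwa [mem_closedBall_iff_norm]
  obtain ⟨α, hα0, hα⟩ : ∃ α : ℝ, 0 < α ∧ (M:ℝ) < 4 * α ^ 2 * δ ^ 2 - 2 * α * N := by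
    have hMn : (0:ℝ) ≤ M := M.2
    have hNn : (0:ℝ) ≤ N := Nat.cast_nonneg _
    have hα0 : 0 < ((N:ℝ) + M + 1) / (2 * δ ^ 2) := by positivity
    refine ⟨_, hα0, ?_⟩
    set α := ((N:ℝ) + M + 1) / (2 * δ ^ 2) with hαd
    have h1 : α * (2 * δ ^ 2) = N + M + 1 := div_mul_cancel₀ _ (by positivity)
    have h2 : 1 ≤ 2 * α := by
      by_contra hc
      push Not at hc
      have h3 : α * (2 * δ ^ 2) ≤ α * (2 * 1) := by
        apply mul_le_mul_of_nonneg_left _ hα0.le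
        nlinarith
      linarith
    have h4 : 4 * α ^ 2 * δ ^ 2 - 2 * α * N = 2 * α * (M + 1) := by linear_combination 2 * α * h1
    rw [h4]
    nlinarith
  set E : EuclideanSpace ℝ (Fin N) → ℝ := fun x => Real.exp (-α * (‖x - y‖ ^ 2 - ρ ^ 2)) with hE
  have hEc : Continuous E := by simp only [hE]; fun_prop
  set η := m / Real.exp (α * ρ ^ 2) with hη
  have hη0 : 0 < η := by positivity
  have hηE : ∀ x, η * E x ≤ m := by
    intro x
    rw [hη, div_mul_eq_mul_div, div_le_iff₀ (Real.exp_pos _)]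
    apply mul_le_mul_of_nonneg_left _ hm0.le
    apply Real.exp_le_exp.2
    have : 0 ≤ α * ‖x - y‖ ^ 2 := by positivity
    linarith
  obtain ⟨z, hz, hzm⟩ := hcB.exists_isMinOn ⟨y, mem_closedBall_self hρ.le⟩
    (hwc.sub ((hEc.sub continuous_const).const_smul η).continuousOn (g := fun x => η • (E x - 1)))
  rw [mem_closedBall_iff_norm] at hz
  have hzv : w z - η * (E z - 1) < 0 := by
    have h1 : w z - η * (E z - 1) ≤ w x₁ - η * (E x₁ - 1) := hzm (mem_closedBall_iff_norm.2 hx₁.le)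
    have h2 : 1 < E x₁ := by
      apply Real.one_lt_exp_iff.2
      have : ‖x₁ - y‖ ^ 2 < ρ ^ 2 := pow_lt_pow_left₀ hx₁ (norm_nonneg _) (by norm_num)
      nlinarith
    have h3 : 0 < η * (E x₁ - 1) := mul_pos hη0 (by linarith)
    linarith
  have hz1 : ‖z - y‖ < ρ := by
    refine lt_of_le_of_ne hz fun hc => ?_
    have h1 : E z = 1 := by simp [hE, hc]
    have := hw0 z (hy z hz).1 (hy z hz).2
    rw [h1] at hzv
    simp only [hw] at hzv
    linarith
  have hz2 : δ < ‖z - y‖ := by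
    by_contra hc
    push Not at hc
    have h1 := hm z hc
    have h2 := hηE z
    linarith
  have hmin : IsLocalMin (fun x => u x - u (rfl' (b i₀) l x) - η * (E x - 1)) z := by
    have o2 : ∀ᶠ x in 𝓝 z, x ∈ ball y ρ := isOpen_ball.mem_nhds (mem_ball_iff_norm.2 hz1)
    filter_upwards [o2] with x x2
    exact hzm (ball_subset_closedBall x2)
  have hg : ∀ i, HD2 (fun t : ℝ => η * (E (z + t • b i) - 1)) _ _ := fun i =>
    ((HD2.gauss z y (b i) (b.orthonormal.1 i) (-α) (ρ ^ 2)).sub (HD2.const (1:ℝ))).const_mul η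
  have hfin := mp_refl hu (hy z hz).1 (hrf z (mem_closedBall_iff_norm.2 hz)) hg hmin
  rw [← Finset.mul_sum, Finset.sum_sub_distrib, gauss_sum] at hfin
  have hwz0 : 0 ≤ w z := by
    have := hw0 z (hy z hz).1 (hy z hz).2
    simp only [hw]; linarith
  have hLip : f (u z) - f (u (rfl' (b i₀) l z)) ≤ M * w z := by
    have h1 := hM.dist_le_mul (u z) (Or.inl ⟨z, mem_closedBall_iff_norm.2 hz, rfl⟩)
      (u (rfl' (b i₀) l z)) (Or.inr ⟨z, mem_closedBall_iff_norm.2 hz, rfl⟩)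
    rw [Real.dist_eq, Real.dist_eq] at h1
    have h2 : |u z - u (rfl' (b i₀) l z)| = w z := abs_of_nonneg hwz0
    rw [h2] at h1
    exact (le_abs_self _).trans h1
  have hEp : 0 < E z := Real.exp_pos _
  have hEp' : 0 < η * E z := mul_pos hη0 hEp
  have h3 : (M:ℝ) * w z ≤ M * (η * E z) := mul_le_mul_of_nonneg_left (by linarith) M.2
  have h4 : η * E z * (4 * α ^ 2 * ‖z - y‖ ^ 2 - 2 * α * N) ≤ M * (η * E z) := by
    refine le_trans (le_of_eq ?_) (hfin.trans (hLip.trans h3))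
    simp [hE]; ring
  have h5 : 4 * α ^ 2 * δ ^ 2 ≤ 4 * α ^ 2 * ‖z - y‖ ^ 2 := by
    apply mul_le_mul_of_nonneg_left _ (by positivity)
    exact pow_le_pow_left₀ hδ0.le hz2.le 2
  have h6 : η * E z * M < η * E z * (4 * α ^ 2 * ‖z - y‖ ^ 2 - 2 * α * N) :=
    mul_lt_mul_of_pos_left (by linarith) hEp'
  linarith

lemma smp {N : ℕ} {f : ℝ → ℝ} {u : EuclideanSpace ℝ (Fin N) → ℝ} (hu : IsBlowUp f u)
    (hf : ContDiff ℝ 1 f) {e : EuclideanSpace ℝ (Fin N)} (he : ‖e‖ = 1) {l : ℝ} (hl : 0 < l) (hl1 : l < 1)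
    (hw0 : ∀ x, ‖x‖ < 1 → l < inner ℝ e x → u (rfl' e l x) ≤ u x) :
    ∀ x, ‖x‖ < 1 → l < inner ℝ e x → u (rfl' e l x) < u x := by
  have ci : Continuous fun x : EuclideanSpace ℝ (Fin N) => inner ℝ e x := by fun_prop
  have cr : Continuous fun x : EuclideanSpace ℝ (Fin N) => rfl' e l x := by unfold rfl'; fun_prop
  set S : Set (EuclideanSpace ℝ (Fin N)) := {x | ‖x‖ < 1 ∧ l < inner ℝ e x} with hS
  have hSo : IsOpen S := (isOpen_lt continuous_norm continuous_const).inter (isOpen_lt continuous_const ci)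
  have hSc : Convex ℝ S := by
    have h1 : Convex ℝ (ball (0 : EuclideanSpace ℝ (Fin N)) 1) := convex_ball _ _
    have h2 : Convex ℝ {x : EuclideanSpace ℝ (Fin N) | l < inner ℝ e x} :=
      convex_halfSpace_gt (f := fun x => inner ℝ e x) (innerSL ℝ e).isLinear l
    convert h1.inter h2 using 1
    ext x; simp [hS]
  set U : Set (EuclideanSpace ℝ (Fin N)) := {x | x ∈ S ∧ u (rfl' e l x) < u x} with hU
  have hUo : IsOpen U := by
    rw [isOpen_iff_mem_nhds]
    rintro x ⟨h1, h2⟩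
    have c1 : ContinuousAt u x := (hu.cd h1.1).continuousAt
    have c2 : ContinuousAt (fun x => u (rfl' e l x)) x :=
      ContinuousAt.comp (f := fun x => rfl' e l x) (hu.cd (lt_of_le_of_lt (rfl'_norm_le he hl.le h1.2.le) h1.1)).continuousAt cr.continuousAt
    filter_upwards [hSo.mem_nhds h1, c2.eventually_lt c1 h2] with z z1 z2 using ⟨z1, z2⟩
  have hsub : S ⊆ U := by
    refine hSc.isPreconnected.subset_of_closure_inter_subset hUo ?_ ?_
    · have hp : ‖(2 * l - 1) • e‖ < 1 := by
        rw [norm_smul, he, mul_one, Real.norm_eq_abs, abs_lt]; constructor <;> linarith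
      obtain ⟨ρ, r0, r1, r2⟩ := hu.unif (u ((2 * l - 1) • e) + 1)
      have c1 : ContinuousAt (fun t : ℝ => u ((2 * l - t) • e)) 1 :=
        ContinuousAt.comp (f := fun t : ℝ => (2 * l - t) • e) (hu.cd hp).continuousAt (by fun_prop)
      have e1 := c1.eventually_lt_const (show u ((2 * l - 1) • e) < u ((2 * l - 1) • e) + 1 by linarith)
      have e2 : ∀ᶠ t : ℝ in 𝓝[<] 1, max l ρ < t := nhdsWithin_le_nhds (Ioi_mem_nhds (max_lt hl1 r1))
      obtain ⟨t, t1, t2, t3⟩ := ((e1.filter_mono nhdsWithin_le_nhds).and (e2.and (self_mem_nhdsWithin (s := Iio (1:ℝ))))).exists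
      have t4 : l < t := lt_of_le_of_lt (le_max_left _ _) t2
      have t5 : ρ < t := lt_of_le_of_lt (le_max_right _ _) t2
      have hn : ‖t • e‖ = t := by rw [norm_smul, he, mul_one, Real.norm_eq_abs, abs_of_pos (by linarith)]
      have hi : inner ℝ e (t • e) = t := by rw [inner_smul_right, real_inner_self_eq_norm_sq, he]; simp
      have hr : rfl' e l (t • e) = (2 * l - t) • e := by
        rw [rfl', hi]; module
      have hts : t • e ∈ S := ⟨by rw [hn]; exact t3, by rw [hi]; exact t4⟩
      refine ⟨t • e, hts, hts, ?_⟩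
      have := r2 (t • e) (by rw [hn]; exact t5.le) hts.1
      rw [hr]
      linarith
    · rintro x ⟨hx, hxS⟩
      refine ⟨hxS, ?_⟩
      obtain ⟨ρ, hρ, hb⟩ := Metric.isOpen_iff.1 hSo x hxS
      obtain ⟨y, hyU, hy⟩ := Metric.mem_closure_iff.1 hx (ρ / 3) (by positivity)
      rw [dist_eq_norm] at hy
      refine smp_local hu hf he hl.le hw0 (ρ := ρ / 3) (by positivity) ?_ hyU.2 x hy
      intro x' hx'
      apply hb
      rw [mem_ball_iff_norm]
      calc ‖x' - x‖ = ‖(x' - y) - (x - y)‖ := by congr 1; abel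
        _ ≤ ‖x' - y‖ + ‖x - y‖ := norm_sub_le _ _
        _ < ρ := by linarith
  exact fun x h1 h2 => (hsub ⟨h1, h2⟩).2
lemma moving_lim {N : ℕ} {f : ℝ → ℝ} {u : EuclideanSpace ℝ (Fin N) → ℝ} (hu : IsBlowUp f u)
    {e : EuclideanSpace ℝ (Fin N)} (he : ‖e‖ = 1) {l₀ : ℝ} (h0 : 0 ≤ l₀) (h1 : l₀ < 1)
    (hP : ∀ l, l₀ < l → l < 1 → ∀ x, ‖x‖ < 1 → l < inner ℝ e x → u (rfl' e l x) ≤ u x) :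
    ∀ x, ‖x‖ < 1 → l₀ < inner ℝ e x → u (rfl' e l₀ x) ≤ u x := by
  intro x hx hlx
  have hn : ‖rfl' e l₀ x‖ < 1 := lt_of_le_of_lt (rfl'_norm_le he h0 hlx.le) hx
  have c1 : ContinuousAt (fun l : ℝ => u (rfl' e l x)) l₀ :=
    ContinuousAt.comp (f := fun l : ℝ => rfl' e l x) (hu.cd hn).continuousAt (by unfold rfl'; fun_prop)
  refine le_of_tendsto (c1.tendsto.mono_left (nhdsWithin_le_nhds (s := Ioi l₀))) ?_
  have e2 : ∀ᶠ t : ℝ in 𝓝[>] l₀, t < min 1 (inner ℝ e x) := nhdsWithin_le_nhds (Iio_mem_nhds (lt_min h1 hlx))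
  filter_upwards [e2, self_mem_nhdsWithin] with l a1 a2
  exact hP l a2 (lt_of_lt_of_le a1 (min_le_left _ _)) x hx (lt_of_lt_of_le a1 (min_le_right _ _))

lemma moving {N : ℕ} {f : ℝ → ℝ} {u : EuclideanSpace ℝ (Fin N) → ℝ} (hu : IsBlowUp f u)
    (hf : ContDiff ℝ 1 f) (hN : 1 ≤ N) {a K : ℝ} (hf0 : ∀ t > a, 0 ≤ f t)
    (hK : 0 ≤ K) (hKf : ∀ s t, s ≤ t → f s - f t ≤ K * (t - s))
    {e : EuclideanSpace ℝ (Fin N)} (he : ‖e‖ = 1) :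
    ∀ l, 0 < l → l < 1 → ∀ x, ‖x‖ < 1 → l < inner ℝ e x → u (rfl' e l x) ≤ u x := by
  obtain ⟨r₁, A, hr₁, hA, hbd⟩ := hbd_lem hu hN hf0 hK hKf
  obtain ⟨L, hL⟩ : ∃ L, L = K + 1 := ⟨_, rfl⟩
  have hL1 : 1 ≤ L := by linarith
  have hc0 : 0 < 1 / (32 * L) := by positivity
  have hc2 : 1 / (16 * L) = 2 * (1 / (32 * L)) := by field_simp; norm_num
  set c := 1 / (32 * L) with hc
  have hin : ∀ x, inner ℝ e x ≤ ‖x‖ := fun x => by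
    have := real_inner_le_norm e x
    rwa [he, one_mul] at this
  have hstart : ∀ l, 0 ≤ l → 1 - c ≤ l → ∀ x, ‖x‖ < 1 → l < inner ℝ e x → u (rfl' e l x) ≤ u x := by
    intro l h0 h1
    refine narrow hu hK hL hKf hr₁ hA hbd he h0 (t₀ := l) (by rw [hc2]; linarith) ?_
    intro x _ h3 h4
    have := hin x
    linarith
  by_contra hcon
  set S : Set ℝ := {l | 0 < l ∧ l < 1 ∧ ¬ ∀ x, ‖x‖ < 1 → l < inner ℝ e x → u (rfl' e l x) ≤ u x} with hS
  have hSne : S.Nonempty := by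
    push Not at hcon
    obtain ⟨l, h1, h2, x, h3, h4, h5⟩ := hcon
    refine ⟨l, h1, h2, fun h => ?_⟩
    have := h x h3 h4
    linarith
  have hSb : ∀ l ∈ S, l ≤ 1 - c := by
    intro l hl
    by_contra hcc
    push Not at hcc
    exact hl.2.2 (hstart l hl.1.le hcc.le)
  have hSbdd : BddAbove S := ⟨_, hSb⟩
  set l₀ := sSup S with hl₀
  have hl0 : 0 < l₀ := by
    obtain ⟨l, hl⟩ := hSne
    exact lt_of_lt_of_le hl.1 (le_csSup hSbdd hl)
  have hl1 : l₀ < 1 := lt_of_le_of_lt (csSup_le hSne hSb) (by linarith)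
  have hP : ∀ l, l₀ < l → l < 1 → ∀ x, ‖x‖ < 1 → l < inner ℝ e x → u (rfl' e l x) ≤ u x := by
    intro l h1 h2
    by_contra h3
    have := le_csSup hSbdd (show l ∈ S from ⟨by linarith, h2, h3⟩)
    linarith
  have hstr := smp hu hf he hl0 hl1 (moving_lim hu he hl0.le hl1 hP)
  set C : Set (EuclideanSpace ℝ (Fin N)) := {x | l₀ + c ≤ inner ℝ e x ∧ ‖x‖ ≤ 1 - c} with hC
  have hCc : IsCompact C := by
    refine (isCompact_closedBall (0 : EuclideanSpace ℝ (Fin N)) (1 - c)).of_isClosed_subset ?_ ?_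
    · have ci : Continuous fun x : EuclideanSpace ℝ (Fin N) => inner ℝ e x := by fun_prop
      exact (isClosed_le continuous_const ci).inter (isClosed_le continuous_norm continuous_const)
    · intro x hx; simpa using hx.2
  have hev : ∀ᶠ l in 𝓝 l₀, ∀ x ∈ C, u (rfl' e l x) ≤ u x := by
    refine hCc.eventually_forall_of_forall_eventually (P := fun l x => u (rfl' e l x) ≤ u x) fun x hx => ?_
    have hx1 : ‖x‖ < 1 := by linarith [hx.2]
    have hlx : l₀ < inner ℝ e x := by linarith [hx.1]
    have hn : ‖rfl' e l₀ x‖ < 1 := lt_of_le_of_lt (rfl'_norm_le he hl0.le hlx.le) hx1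
    have c1 : ContinuousAt (fun z : ℝ × EuclideanSpace ℝ (Fin N) => u (rfl' e z.1 z.2)) (l₀, x) :=
      ContinuousAt.comp (f := fun z : ℝ × EuclideanSpace ℝ (Fin N) => rfl' e z.1 z.2) (x := (l₀, x))
        (hu.cd hn).continuousAt (by unfold rfl'; fun_prop)
    have c2 : ContinuousAt (fun z : ℝ × EuclideanSpace ℝ (Fin N) => u z.2) (l₀, x) :=
      ContinuousAt.comp (f := fun z : ℝ × EuclideanSpace ℝ (Fin N) => z.2) (x := (l₀, x))
        (hu.cd hx1).continuousAt (by fun_prop)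
    filter_upwards [c1.eventually_lt c2 (hstr x hx1 hlx)] with z hz using hz.le
  obtain ⟨δ, hδ, hδ2⟩ := Metric.eventually_nhds_iff.1 hev
  obtain ⟨l, hlS, hl⟩ := exists_lt_of_lt_csSup hSne (show l₀ - min δ c < sSup S by
    have := lt_min hδ hc0
    linarith)
  have hll : l ≤ l₀ := le_csSup hSbdd hlS
  refine hlS.2.2 (narrow hu hK hL hKf hr₁ hA hbd he hlS.1.le (t₀ := l₀ + c) ?_ ?_)
  · rw [hc2]
    have := min_le_right δ c
    linarith
  · intro x h1 h2 h3
    refine hδ2 ?_ x ⟨h1, h3⟩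
    rw [Real.dist_eq, abs_lt]
    have := min_le_left δ c
    constructor <;> linarith

lemma radial {N : ℕ} {f : ℝ → ℝ} {u : EuclideanSpace ℝ (Fin N) → ℝ} (hu : IsBlowUp f u)
    (hf : ContDiff ℝ 1 f) (hN : 1 ≤ N) {a K : ℝ} (hf0 : ∀ t > a, 0 ≤ f t)
    (hK : 0 ≤ K) (hKf : ∀ s t, s ≤ t → f s - f t ≤ K * (t - s))
    {x y : EuclideanSpace ℝ (Fin N)} (hx : ‖x‖ < 1) (hxy : ‖x‖ = ‖y‖) : u x = u y := by
  have key : ∀ x y : EuclideanSpace ℝ (Fin N), ‖x‖ < 1 → ‖x‖ = ‖y‖ → u y ≤ u x := by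
    intro x y hx hxy
    rcases eq_or_ne x y with h | h
    · rw [h]
    have hd : 0 < ‖x - y‖ := norm_pos_iff.2 (sub_ne_zero.2 h)
    set e := ‖x - y‖⁻¹ • (x - y) with he
    have he1 : ‖e‖ = 1 := by
      rw [he, norm_smul, norm_inv, norm_norm, inv_mul_cancel₀ hd.ne']
    have hi : inner ℝ e x = ‖x - y‖ / 2 := by
      rw [he, real_inner_smul_left, inner_sub_left, real_inner_self_eq_norm_sq]
      have h2 := norm_sub_sq_real x y
      rw [← hxy] at h2
      rw [real_inner_comm x y]
      field_simp
      linarith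
    have hr : rfl' e 0 x = y := by
      rw [rfl', hi, he, smul_smul]
      have : 2 * (0 - ‖x - y‖ / 2) * ‖x - y‖⁻¹ = -1 := by field_simp; ring
      rw [this]; module
    have := moving_lim hu he1 le_rfl one_pos (moving hu hf hN hf0 hK hKf he1) x hx (by rw [hi]; positivity)
    rwa [hr] at this
  exact le_antisymm (key y x (hxy ▸ hx) hxy.symm) (key x y hx hxy)
lemma monoI {g g' : ℝ → ℝ} {s t : ℝ} (hst : s ≤ t) (hd : ∀ x ∈ Icc s t, HasDerivAt g (g' x) x)
    (h0 : ∀ x ∈ Ioo s t, 0 ≤ g' x) : g s ≤ g t := by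
  refine monotoneOn_of_deriv_nonneg (convex_Icc s t)
    (fun x hx => (hd x hx).continuousAt.continuousWithinAt) ?_ ?_ (left_mem_Icc.2 hst) (right_mem_Icc.2 hst) hst
  · rw [interior_Icc]
    exact fun x hx => (hd x (Ioo_subset_Icc_self hx)).differentiableAt.differentiableWithinAt
  · rw [interior_Icc]
    intro x hx
    rw [(hd x (Ioo_subset_Icc_self hx)).deriv]
    exact h0 x hx

lemma strictI {g g' : ℝ → ℝ} {s t : ℝ} (hst : s < t) (hd : ∀ x ∈ Icc s t, HasDerivAt g (g' x) x)
    (h0 : ∀ x ∈ Ioo s t, 0 < g' x) : g s < g t := by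
  refine strictMonoOn_of_deriv_pos (convex_Icc s t)
    (fun x hx => (hd x hx).continuousAt.continuousWithinAt) ?_ (left_mem_Icc.2 hst.le) (right_mem_Icc.2 hst.le) hst
  rw [interior_Icc]
  intro x hx
  rw [(hd x (Ioo_subset_Icc_self hx)).deriv]
  exact h0 x hx

lemma oned {n : ℕ} {w p p' q : ℝ → ℝ} {C : ℝ} (hC : 0 ≤ C)
    (hw : ∀ r ∈ Ico (1/2 : ℝ) 1, HasDerivAt w (p r) r)
    (hp : ∀ r ∈ Ico (1/2 : ℝ) 1, HasDerivAt p (p' r) r)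
    (hG : ∀ r ∈ Ico (1/2 : ℝ) 1, HasDerivAt (fun s => s ^ n * p s) (r ^ n * q r) r)
    (hq1 : ∀ r ∈ Ico (1/2 : ℝ) 1, 0 ≤ w r → - C ≤ q r)
    (hq2 : ∀ r ∈ Ico (1/2 : ℝ) 1, w r ≤ 0 → q r ≤ C)
    (hlim : Tendsto w (𝓝[<] 1) (𝓝 0)) :
    ∃ B : ℝ, ∀ r ∈ Ico (1/2 : ℝ) 1, p r ≤ B := by
  set G : ℝ → ℝ := fun s => s ^ n * p s with hGd
  have hpow : ∀ r ∈ Ico (1/2 : ℝ) 1, 0 < r ^ n ∧ r ^ n ≤ 1 := by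
    intro r hr
    have : 0 < r := by linarith [hr.1]
    exact ⟨by positivity, pow_le_one₀ this.le hr.2.le⟩
  have hpc : ∀ s t, 1/2 ≤ s → t < 1 → ContinuousOn p (Icc s t) := fun s t hs ht x hx =>
    (hp x ⟨by linarith [hx.1], by linarith [hx.2]⟩).continuousAt.continuousWithinAt
  have hdC : ∀ r ∈ Ico (1/2 : ℝ) 1, ∀ σ : ℝ, HasDerivAt (fun s => G s + σ * s) (r ^ n * q r + σ) r := by
    intro r hr σ
    simpa using (hG r hr).fun_add ((hasDerivAt_id' r).const_mul σ)
  have key : ∀ r ∈ Ico (1/2 : ℝ) 1, G r ≤ |G (1/2)| + C := by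
    intro r hr
    by_contra hcon
    push Not at hcon
    have hG0 := abs_nonneg (G (1/2))
    have hpr : 0 < p r := by
      have h1 : 0 < r ^ n * p r := by linarith
      exact (mul_pos_iff_of_pos_left (hpow r hr).1).1 h1
    rcases le_or_gt 0 (w r) with hwr | hwr
    · by_cases hZ : ∃ t, r ≤ t ∧ t < 1 ∧ p t ≤ 0
      · obtain ⟨t, t1, t2, t3⟩ := hZ
        have hcomp : IsCompact {s | s ∈ Icc r t ∧ p s ∈ Iic 0} :=
          isCompact_Icc.of_isClosed_subset ((hpc r t hr.1 t2).preimage_isClosed_of_isClosed isClosed_Icc isClosed_Iic) fun s hs => hs.1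
        obtain ⟨m, ⟨⟨m1, m2⟩, m3⟩, hm⟩ := hcomp.exists_isLeast ⟨t, ⟨t1, le_rfl⟩, t3⟩
        simp only [mem_Iic] at m3
        have hpos : ∀ s ∈ Ico r m, 0 < p s := by
          intro s hs
          by_contra hc
          push Not at hc
          have := hm (show s ∈ {s | s ∈ Icc r t ∧ p s ∈ Iic 0} from ⟨⟨hs.1, by linarith [hs.2]⟩, hc⟩)
          linarith [hs.2]
        have hin : ∀ s ∈ Icc r m, s ∈ Ico (1/2 : ℝ) 1 := fun s hs => ⟨by linarith [hs.1, hr.1], by linarith [hs.2]⟩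
        have hw0 : ∀ s ∈ Icc r m, 0 ≤ w s := by
          intro s hs
          refine hwr.trans (monoI hs.1 (g' := p) (fun x hx => hw x (hin x ⟨hx.1, hx.2.trans hs.2⟩)) ?_)
          intro x hx
          exact (hpos x ⟨hx.1.le, by linarith [hx.2, hs.2]⟩).le
        have := monoI m1 (g := fun s => G s + C * s) (fun x hx => hdC x (hin x hx) C) (by
          intro x hx
          have hx' := Ioo_subset_Icc_self hx
          have h1 := hq1 x (hin x hx') (hw0 x hx')
          obtain ⟨h2, h3⟩ := hpow x (hin x hx')
          nlinarith)
        have hGm : G m ≤ 0 := mul_nonpos_of_nonneg_of_nonpos (hpow m (hin m ⟨m1, le_rfl⟩)).1.le m3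
        have h5 : C * m ≤ C * 1 := mul_le_mul_of_nonneg_left (by linarith) hC
        have h6 : 0 ≤ C * r := mul_nonneg hC (by linarith [hr.1])
        linarith
      · push Not at hZ
        have hr1 := hr.1
        have hr2 := hr.2
        have h1 : w r < w ((r + 1) / 2) := strictI (g' := p) (by linarith)
          (fun x hx => hw x ⟨by linarith [hx.1], by linarith [hx.2]⟩)
          (fun x hx => hZ x hx.1.le (by linarith [hx.2]))
        have h2 : w ((r + 1) / 2) ≤ 0 := by
          refine ge_of_tendsto hlim ?_
          have : ∀ᶠ t : ℝ in 𝓝[<] 1, (r + 1) / 2 < t := nhdsWithin_le_nhds (Ioi_mem_nhds (by linarith))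
          filter_upwards [this, self_mem_nhdsWithin] with t t1 t2
          have t2' : t < 1 := t2
          exact monoI (g' := p) t1.le
            (fun x hx => hw x ⟨by linarith [hx.1], by linarith [hx.2]⟩)
            (fun x hx => (hZ x (by linarith [hx.1]) (by linarith [hx.2])).le)
        linarith
    · obtain ⟨m, m0, m1, hGm, hpos⟩ : ∃ m, 1/2 ≤ m ∧ m ≤ r ∧ G m ≤ |G (1/2)| ∧ ∀ s ∈ Ioc m r, 0 < p s := by
        by_cases hZ : ∃ t, 1/2 ≤ t ∧ t ≤ r ∧ p t ≤ 0
        · obtain ⟨t, t1, t2, t3⟩ := hZ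
          have hcomp : IsCompact {s | s ∈ Icc t r ∧ p s ∈ Iic 0} :=
            isCompact_Icc.of_isClosed_subset ((hpc t r t1 hr.2).preimage_isClosed_of_isClosed isClosed_Icc isClosed_Iic) fun s hs => hs.1
          obtain ⟨m, ⟨⟨m1, m2⟩, m3⟩, hm⟩ := hcomp.exists_isGreatest ⟨t, ⟨le_rfl, t2⟩, t3⟩
          simp only [mem_Iic] at m3
          refine ⟨m, by linarith, m2, ?_, ?_⟩
          · have : G m ≤ 0 := mul_nonpos_of_nonneg_of_nonpos (hpow m ⟨by linarith, by linarith [hr.2]⟩).1.le m3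
            linarith
          · intro s hs
            by_contra hc
            push Not at hc
            have := hm (show s ∈ {s | s ∈ Icc t r ∧ p s ∈ Iic 0} from ⟨⟨by linarith [hs.1], hs.2⟩, hc⟩)
            linarith [hs.1]
        · push Not at hZ
          exact ⟨1/2, le_rfl, hr.1, le_abs_self _, fun s hs => hZ s hs.1.le hs.2⟩
      have hin : ∀ s ∈ Icc m r, s ∈ Ico (1/2 : ℝ) 1 := fun s hs => ⟨by linarith [hs.1], by linarith [hs.2, hr.2]⟩
      have hw0 : ∀ s ∈ Icc m r, w s ≤ 0 := by
        intro s hs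
        refine (monoI hs.2 (g' := p) (fun x hx => hw x (hin x ⟨hs.1.trans hx.1, hx.2⟩)) ?_).trans hwr.le
        intro x hx
        exact (hpos x ⟨by linarith [hx.1, hs.1], hx.2.le⟩).le
      have hmn := monoI m1 (g := fun s => -(G s + (-C) * s)) (fun x hx => (hdC x (hin x hx) (-C)).neg) (by
        intro x hx
        have hx' := Ioo_subset_Icc_self hx
        have h1 := hq2 x (hin x hx') (hw0 x hx')
        obtain ⟨h2, h3⟩ := hpow x (hin x hx')
        nlinarith)
      have h5 : C * r ≤ C * 1 := mul_le_mul_of_nonneg_left (by linarith [hr.2]) hC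
      have h6 : 0 ≤ C * m := mul_nonneg hC (by linarith)
      linarith
  refine ⟨(|G (1/2)| + C) / (1/2) ^ n, fun r hr => ?_⟩
  rcases le_or_gt (p r) 0 with h | h
  · exact h.trans (by positivity)
  · rw [le_div_iff₀ (by positivity)]
    have h1 : (1/2 : ℝ) ^ n ≤ r ^ n := pow_le_pow_left₀ (by norm_num) hr.1 n
    have h2 := key r hr
    have h3 : p r * (1/2 : ℝ) ^ n ≤ p r * r ^ n := mul_le_mul_of_nonneg_left h1 h.le
    simp only [hGd] at h2 ⊢
    linarith [mul_comm (p r) (r ^ n)]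
lemma ode_data {N : ℕ} {f : ℝ → ℝ} {u : EuclideanSpace ℝ (Fin N) → ℝ} (hu : IsBlowUp f u) (hN : 1 ≤ N)
    (hrad : ∀ x y : EuclideanSpace ℝ (Fin N), ‖x‖ < 1 → ‖x‖ = ‖y‖ → u x = u y)
    {e : EuclideanSpace ℝ (Fin N)} (he : ‖e‖ = 1) {r : ℝ} (hr : r ∈ Ico (1/2 : ℝ) 1) :
    HasDerivAt (fun s : ℝ => u (s • e)) (fderiv ℝ u (r • e) e) r ∧
    HasDerivAt (fun s : ℝ => fderiv ℝ u (s • e) e) (D2 u (r • e) e) r ∧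
    HasDerivAt (fun s : ℝ => s ^ (N - 1) * fderiv ℝ u (s • e) e) (r ^ (N - 1) * f (u (r • e))) r := by
  have hr0 : 0 < r := by linarith [hr.1]
  have hn : ‖r • e‖ = r := by rw [norm_smul, he, mul_one, Real.norm_eq_abs, abs_of_pos hr0]
  have hn1 : ‖r • e‖ < 1 := by rw [hn]; exact hr.2
  have hcd := hu.cd hn1
  have hline : HasDerivAt (fun s : ℝ => s • e) e r := by simpa using (hasDerivAt_id r).smul_const e
  have h1 : HasDerivAt (fun s : ℝ => u (s • e)) (fderiv ℝ u (r • e) e) r :=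
    HasFDerivAt.comp_hasDerivAt (f := fun s : ℝ => s • e) r (hcd.differentiableAt (by norm_num)).hasFDerivAt hline
  have hd2 : DifferentiableAt ℝ (fderiv ℝ u) (r • e) :=
    (hcd.fderiv_right (m := 1) (by norm_num)).differentiableAt (by norm_num)
  have h2' : HasDerivAt (fun s : ℝ => fderiv ℝ u (s • e)) (fderiv ℝ (fderiv ℝ u) (r • e) e) r :=
    HasFDerivAt.comp_hasDerivAt (f := fun s : ℝ => s • e) r hd2.hasFDerivAt hline
  have h2 : HasDerivAt (fun s : ℝ => fderiv ℝ u (s • e) e) (D2 u (r • e) e) r := by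
    have := h2'.clm_apply (hasDerivAt_const r e)
    simpa [D2] using this
  refine ⟨h1, h2, ?_⟩
  have hle := tang_le hr0 he hcd (fun x hx => (hrad (r • e) x hn1 (by rw [hn, hx])).ge)
  have hge := tang_ge hr0 he hcd (fun x hx => (hrad (r • e) x hn1 (by rw [hn, hx])).le)
  have heq := hu.eq hn1
  have hD : D2 u (r • e) e = f (u (r • e)) - (N - 1) / r * fderiv ℝ u (r • e) e := by linarith
  have h3 := ((hasDerivAt_pow (N - 1) r).fun_mul h2)
  refine h3.congr_deriv ?_
  rw [hD]
  obtain ⟨n, rfl⟩ : ∃ n, N = n + 1 := ⟨N - 1, by omega⟩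
  simp only [Nat.add_sub_cancel, Nat.cast_add, Nat.cast_one, add_sub_cancel_right]
  rcases Nat.eq_zero_or_pos n with h | h
  · subst h; simp
  · obtain ⟨k, rfl⟩ : ∃ k, n = k + 1 := ⟨n - 1, by omega⟩
    simp only [Nat.add_sub_cancel, pow_succ]
    field_simp
    ring

lemma one_sided {N : ℕ} {f : ℝ → ℝ} {u v : EuclideanSpace ℝ (Fin N) → ℝ} (hu : IsBlowUp f u)
    (hv : IsBlowUp f v) (hf : ContDiff ℝ 1 f) (hN : 1 ≤ N) {a K : ℝ} (hf0 : ∀ t > a, 0 ≤ f t)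
    (hK : 0 ≤ K) (hKf : ∀ s t, s ≤ t → f s - f t ≤ K * (t - s))
    {e : EuclideanSpace ℝ (Fin N)} (he : ‖e‖ = 1) :
    ∃ B : ℝ, ∀ r ∈ Ico (1/2 : ℝ) 1, fderiv ℝ u (r • e) e - fderiv ℝ v (r • e) e ≤ B := by
  have hu' := fun r hr => ode_data hu hN (fun x y h1 h2 => radial hu hf hN hf0 hK hKf h1 h2) he (r := r) hr
  have hv' := fun r hr => ode_data hv hN (fun x y h1 h2 => radial hv hf hN hf0 hK hKf h1 h2) he (r := r) hr
  obtain ⟨r₁, A₁, a0, a1, a2, a3⟩ := double_cmp hu hv hN hf0 hK hKf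
  obtain ⟨r₂, A₂, b0, b1, b2, b3⟩ := double_cmp hv hu hN hf0 hK hKf
  have hn : ∀ r : ℝ, 0 ≤ r → ‖r • e‖ = r := fun r hr0 => by
    rw [norm_smul, he, mul_one, Real.norm_eq_abs, abs_of_nonneg hr0]
  have hnear : ∀ r, max r₁ r₂ ≤ r → r < 1 → |u (r • e) - v (r • e)| ≤ (A₁ + A₂) * (1 - r) := by
    intro r h1 h2
    have h3 : r₁ ≤ r := le_trans (le_max_left _ _) h1
    have h4 : r₂ ≤ r := le_trans (le_max_right _ _) h1
    have h5 := hn r (by linarith)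
    have c1 := a3 (r • e) (r • e) (by rwa [h5]) (by rwa [h5]) rfl
    have c2 := b3 (r • e) (r • e) (by rwa [h5]) (by rwa [h5]) rfl
    rw [h5] at c1 c2
    have d1 := mul_nonneg a2 (sub_nonneg.2 h2.le)
    have d2 := mul_nonneg b2 (sub_nonneg.2 h2.le)
    rw [abs_le]; constructor <;> linarith
  have hm : max r₁ r₂ < 1 := max_lt a1 b1
  have hlim : Tendsto (fun r : ℝ => u (r • e) - v (r • e)) (𝓝[<] 1) (𝓝 0) := by
    have h0 : Tendsto (fun r : ℝ => (A₁ + A₂) * (1 - r)) (𝓝[<] 1) (𝓝 0) := by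
      have : Continuous fun ρ : ℝ => (A₁ + A₂) * (1 - ρ) := by fun_prop
      have := this.tendsto 1
      simp only [sub_self, mul_zero] at this
      exact this.mono_left nhdsWithin_le_nhds
    refine squeeze_zero_norm' ?_ h0
    have e1 : ∀ᶠ t : ℝ in 𝓝[<] 1, max r₁ r₂ ≤ t := nhdsWithin_le_nhds (Ici_mem_nhds hm)
    filter_upwards [e1, self_mem_nhdsWithin] with t t1 t2
    exact hnear t t1 t2
  obtain ⟨W, hW⟩ : ∃ W, ∀ r ∈ Ico (1/2 : ℝ) 1, |u (r • e) - v (r • e)| ≤ W := by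
    have hc : ContinuousOn (fun r : ℝ => u (r • e) - v (r • e)) (Icc 0 (max r₁ r₂)) := by
      have hc' : ContinuousOn (fun x => u x - v x) (ball (0 : EuclideanSpace ℝ (Fin N)) 1) :=
        (hu.contOn fun x hx => by simpa using hx).sub (hv.contOn fun x hx => by simpa using hx)
      refine hc'.comp (f := fun r : ℝ => r • e) (by fun_prop) ?_
      intro r hr
      rw [mem_ball_zero_iff, hn r hr.1]
      exact lt_of_le_of_lt hr.2 hm
    obtain ⟨W, hW⟩ := isCompact_Icc.exists_bound_of_continuousOn hc
    refine ⟨max W (A₁ + A₂), fun r hr => ?_⟩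
    rcases le_total r (max r₁ r₂) with h | h
    · exact (hW r ⟨by linarith [hr.1], h⟩).trans (le_max_left _ _)
    · refine ((hnear r h hr.2).trans ?_).trans (le_max_right _ _)
      have : 0 ≤ (A₁ + A₂) * r := mul_nonneg (by linarith) (by linarith [hr.1])
      linarith
  have hW0 : 0 ≤ W := (abs_nonneg _).trans (hW (1/2) ⟨le_rfl, by norm_num⟩)
  refine oned (n := N - 1) (C := K * W) (mul_nonneg hK hW0)
    (w := fun r => u (r • e) - v (r • e))
    (p' := fun r => D2 u (r • e) e - D2 v (r • e) e)
    (q := fun r => f (u (r • e)) - f (v (r • e)))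
    (fun r hr => (hu' r hr).1.fun_sub (hv' r hr).1) (fun r hr => (hu' r hr).2.1.fun_sub (hv' r hr).2.1) ?_ ?_ ?_ hlim
  · intro r hr
    have := (hu' r hr).2.2.fun_sub (hv' r hr).2.2
    simpa only [mul_sub] using this
  · intro r hr h
    have h1 := hKf (v (r • e)) (u (r • e)) (by linarith)
    have h2 := mul_le_mul_of_nonneg_left ((le_abs_self _).trans (hW r hr)) hK
    linarith
  · intro r hr h
    have h1 := hKf (u (r • e)) (v (r • e)) (by linarith)
    have h2 := mul_le_mul_of_nonneg_left ((neg_le_abs _).trans (hW r hr)) hK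
    rw [neg_sub] at h2
    exact h1.trans h2

lemma fderiv_radial {N : ℕ} {g : EuclideanSpace ℝ (Fin N) → ℝ} {W : ℝ → ℝ}
    {x : EuclideanSpace ℝ (Fin N)} (hx : x ≠ 0) (hx1 : ‖x‖ < 1)
    (hg : ∀ y : EuclideanSpace ℝ (Fin N), ‖y‖ < 1 → g y = W ‖y‖) {p : ℝ} (hW : HasDerivAt W p ‖x‖) :
    ‖fderiv ℝ g x‖ ≤ |p| := by
  have hnd : DifferentiableAt ℝ (fun y : EuclideanSpace ℝ (Fin N) => ‖y‖) x :=
    differentiableAt_id.norm ℝ hx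
  have h1 := hW.comp_hasFDerivAt x hnd.hasFDerivAt
  have h2 : HasFDerivAt g (p • fderiv ℝ (fun y : EuclideanSpace ℝ (Fin N) => ‖y‖) x) x := by
    refine h1.congr_of_eventuallyEq ?_
    have : ∀ᶠ y in 𝓝 x, ‖y‖ < 1 := (isOpen_lt continuous_norm continuous_const).mem_nhds hx1
    filter_upwards [this] with y hy using hg y hy
  rw [h2.fderiv, norm_smul, Real.norm_eq_abs]
  have h3 : ‖fderiv ℝ (fun y : EuclideanSpace ℝ (Fin N) => ‖y‖) x‖ ≤ (1 : NNReal) :=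
    norm_fderiv_le_of_lipschitz ℝ lipschitzWith_one_norm
  have := mul_le_mul_of_nonneg_left h3 (abs_nonneg p)
  simpa using this
theorem statement2 {N : ℕ} (hN : 1 ≤ N) (f : ℝ → ℝ) (hf : ContDiff ℝ 1 f)
    -- condition (2)
    (a : ℝ) (ha : 0 < f a) (hf0 : ∀ t > a, 0 ≤ f t)
    (F : ℝ → ℝ) (hF : ∀ t, F t = ∫ s in a..t, f s)
    -- condition (3): Keller-Osserman
    (hKO : ∃ T, (∀ t ≥ T, 0 < F t) ∧
      IntegrableOn (fun t => (Real.sqrt (F t))⁻¹) (Ici T))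
    -- f is increasing up to a linear perturbation
    (ftil : ℝ → ℝ) (K : ℝ) (hmono : Monotone ftil)
    (hdecomp : ∀ t, f t = ftil t - K * t)
    (u₁ u₂ : EuclideanSpace ℝ (Fin N) → ℝ)
    (hu₁ : IsBlowUp f u₁) (hu₂ : IsBlowUp f u₂) :
    ∃ C : ℝ, ∀ x ∈ ball (0 : EuclideanSpace ℝ (Fin N)) 1,
      ‖fderiv ℝ (fun y => u₁ y - u₂ y) x‖ ≤ C := by
  have hK : 0 ≤ |K| := abs_nonneg K
  have hKf : ∀ s t, s ≤ t → f s - f t ≤ |K| * (t - s) := by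
    intro s t hst
    have h1 := hmono hst
    have h2 : K * (t - s) ≤ |K| * (t - s) := mul_le_mul_of_nonneg_right (le_abs_self K) (by linarith)
    rw [hdecomp s, hdecomp t]
    linarith
  have : Nonempty (Fin N) := ⟨⟨0, hN⟩⟩
  obtain ⟨e, he⟩ : ∃ e : EuclideanSpace ℝ (Fin N), ‖e‖ = 1 :=
    ⟨EuclideanSpace.single ⟨0, hN⟩ 1, by simp⟩
  obtain ⟨B₁, hB₁⟩ := one_sided hu₁ hu₂ hf hN hf0 hK hKf he
  obtain ⟨B₂, hB₂⟩ := one_sided hu₂ hu₁ hf hN hf0 hK hKf he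
  have hcf : ∀ u, IsBlowUp f u → ContinuousOn (fderiv ℝ u) (closedBall (0 : EuclideanSpace ℝ (Fin N)) (1/2)) := by
    intro u hu
    refine (hu.1.continuousOn_fderiv_of_isOpen isOpen_ball (by norm_num)).mono ?_
    exact closedBall_subset_ball (by norm_num)
  obtain ⟨C, hC⟩ := (isCompact_closedBall (0 : EuclideanSpace ℝ (Fin N)) (1/2)).exists_bound_of_continuousOn
    ((hcf u₁ hu₁).sub (hcf u₂ hu₂))
  refine ⟨max C (max B₁ B₂), fun x hx => ?_⟩
  rw [mem_ball_zero_iff] at hx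
  rcases le_total ‖x‖ (1/2) with h | h
  · rw [fderiv_fun_sub ((hu₁.cd hx).differentiableAt (by norm_num)) ((hu₂.cd hx).differentiableAt (by norm_num))]
    exact (hC x (by simpa using h)).trans (le_max_left _ _)
  · have hr : ‖x‖ ∈ Ico (1/2 : ℝ) 1 := ⟨h, hx⟩
    have hx0 : x ≠ 0 := by
      rintro rfl
      rw [norm_zero] at h; norm_num at h
    have d1 := ode_data hu₁ hN (fun x y h1 h2 => radial hu₁ hf hN hf0 hK hKf h1 h2) he hr
    have d2 := ode_data hu₂ hN (fun x y h1 h2 => radial hu₂ hf hN hf0 hK hKf h1 h2) he hr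
    have hn : ∀ y : EuclideanSpace ℝ (Fin N), ‖y‖ = ‖‖y‖ • e‖ := fun y => by
      rw [norm_smul, he, mul_one, norm_norm]
    refine (fderiv_radial hx0 hx (fun y hy => ?_) (d1.1.fun_sub d2.1)).trans ?_
    · rw [radial hu₁ hf hN hf0 hK hKf hy (hn y), radial hu₂ hf hN hf0 hK hKf hy (hn y)]
    · refine le_trans ?_ (le_max_right _ _)
      have c1 := hB₁ _ hr
      have c2 := hB₂ _ hr
      rw [abs_le']
      refine ⟨c1.trans (le_max_left _ _), ?_⟩
      rw [neg_sub]
      exact c2.trans (le_max_right _ _)
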